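/- Let (R,m) be a Noetherian local ring and M a finitely generated unmixed R-module with dim_R M ≥ 2. Let Q be a parameter ideal for M. Then M is a Cohen–Macaulay R-module if and only if e_1(Q,M) = 0. -/

import Mathlib

open IsLocalRing

section Defs

variable (R : Type) [CommRing R]

/-- The length of a module, as the Krull dimension of its lattice of submodules. -/
noncomputable def mLength (M : Type) [AddCommGroup M] [Module R M] : WithBot ℕ∞ :=
  Order.krullDim (Submodule R M)

/-- The (Krull) dimension of a module. -/
noncomputable def mDim (M : Type) [AddCommGroup M] [Module R M] : WithBot ℕ∞ :=
  ringKrullDim (R ⧸ Submodule.annihilator (⊤ : Submodule R M))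

/-- `f` is eventually given by the Hilbert-type polynomial of degree `t` with
coefficients `s 0, …, s t` (written in the binomial basis with alternating signs). -/
def IsHilbPolyAt (f : ℕ → WithBot ℕ∞) (t : ℕ) (s : ℕ → ℤ) : Prop :=
  ∃ N : ℕ, ∀ n ≥ N, ∃ l : ℕ, f n = (l : ℕ∞) ∧
    (l : ℤ) = ∑ i ∈ Finset.range (t + 1), (-1 : ℤ) ^ i * s i * ((n + t - i).choose (t - i) : ℤ)

/-- `s 0, …, s t` are the Hilbert coefficients `e_i(I, M)`, i.e.
`λ(M/I^{n+1}M) = ∑ (-1)^i e_i(I,M) C(n+t-i, t-i)` for `n ≫ 0`. -/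
def HasHilbCoeffs (I : Ideal R) (M : Type) [AddCommGroup M] [Module R M]
    (t : ℕ) (s : ℕ → ℤ) : Prop :=
  IsHilbPolyAt (fun n => mLength R (M ⧸ (I ^ (n + 1) • (⊤ : Submodule R M)))) t s

/-- The unmixed component `U_M(0)` of `M`: the largest submodule of dimension `< dim M`. -/
noncomputable def unmixedComp (M : Type) [AddCommGroup M] [Module R M] : Submodule R M :=
  sSup {N : Submodule R M | mDim R ↥N < mDim R M}

/-- `x` is a d-sequence on `M`. -/
def IsDSeq {r : ℕ} (x : Fin r → R) (M : Type) [AddCommGroup M] [Module R M] : Prop :=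
  ∀ i j : Fin r, i ≤ j →
    Submodule.comap (LinearMap.lsmul R M (x i * x j))
        (Ideal.span (x '' {k | k < i}) • (⊤ : Submodule R M))
      = Submodule.comap (LinearMap.lsmul R M (x j))
        (Ideal.span (x '' {k | k < i}) • (⊤ : Submodule R M))

/-- `x` is a standard (d⁺-) system: all power sequences in any order are d-sequences. -/
def IsStandardSeq {r : ℕ} (x : Fin r → R) (M : Type) [AddCommGroup M] [Module R M] : Prop :=
  ∀ n : Fin r → ℕ, (∀ k, 1 ≤ n k) → ∀ σ : Equiv.Perm (Fin r),
    IsDSeq R (fun k => x (σ k) ^ n (σ k)) M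

/-- The integral closure of an ideal, as a set. -/
def intClos (Q : Ideal R) : Set R :=
  {x : R | ∃ n : ℕ, 0 < n ∧ ∃ a : ℕ → R, (∀ i, 1 ≤ i → i ≤ n → a i ∈ Q ^ i) ∧
    x ^ n + ∑ i ∈ Finset.Icc 1 n, a i * x ^ (n - i) = 0}

variable [IsLocalRing R]

/-- `h ∈ I` is superficial for `M` with respect to `I`. -/
def IsSuperficial (I : Ideal R) (M : Type) [AddCommGroup M] [Module R M] (h : R) : Prop :=
  h ∈ I ∧ ∃ c N : ℕ, ∀ n ≥ N,
    Submodule.comap (LinearMap.lsmul R M h) (I ^ (n + 1) • (⊤ : Submodule R M))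
        ⊓ (I ^ c • (⊤ : Submodule R M))
      = I ^ n • (⊤ : Submodule R M)

/-- `Q` is a parameter ideal for `M` (`r` the dimension of `M`):
generated by `r` elements of the maximal ideal with `M/QM` of finite length. -/
def IsParamIdeal (Q : Ideal R) (M : Type) [AddCommGroup M] [Module R M] (r : ℕ) : Prop :=
  Q ≤ maximalIdeal R ∧ (∃ x : Fin r → R, Q = Ideal.span (Set.range x)) ∧
    IsFiniteLength R (M ⧸ Q • (⊤ : Submodule R M))

/-- Local cohomology `H^i_𝔪(M)` with support in the maximal ideal. -/
noncomputable def LC (i : ℕ) (M : Type) [AddCommGroup M] [Module R M] : ModuleCat R :=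
  (localCohomology (maximalIdeal R) i).obj (ModuleCat.of R M)

/-- `M` is Cohen–Macaulay: there is a regular sequence on `M` in the maximal ideal
whose length equals `dim M`. -/
def IsCM (M : Type) [AddCommGroup M] [Module R M] : Prop :=
  ∃ rs : List R, (∀ x ∈ rs, x ∈ maximalIdeal R) ∧ RingTheory.Sequence.IsRegular M rs ∧
    (rs.length : WithBot ℕ∞) = mDim R M

/-- `M` is unmixed: `dim R̂/p = dim M` for every associated prime `p` of the completion `M̂`. -/
def IsUnmixed (M : Type) [AddCommGroup M] [Module R M] : Prop :=
  ∀ p ∈ associatedPrimes (AdicCompletion (maximalIdeal R) R)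
      (AdicCompletion (maximalIdeal R) M),
    ringKrullDim ((AdicCompletion (maximalIdeal R) R) ⧸ p) = mDim R M

/-- `M` is generalized Cohen–Macaulay: `H^i_𝔪(M)` has finite length for `i < r = dim M`. -/
def IsGenCM (M : Type) [AddCommGroup M] [Module R M] (r : ℕ) : Prop :=
  ∀ i < r, IsFiniteLength R ↥(LC R i M)

/-- The set `Λ(M)` of first Hilbert coefficients of parameter ideals for `M`. -/
def Lambda (M : Type) [AddCommGroup M] [Module R M] (r : ℕ) : Set ℤ :=
  {a : ℤ | ∃ (Q : Ideal R) (e : ℕ → ℤ),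
    IsParamIdeal R Q M r ∧ HasHilbCoeffs R Q M r e ∧ e 1 = a}

/-- A standard parameter ideal: one generated by a standard system of parameters. -/
def IsStandardParamIdeal (Q : Ideal R) (M : Type) [AddCommGroup M] [Module R M]
    (r : ℕ) : Prop :=
  IsParamIdeal R Q M r ∧ ∃ x : Fin r → R, Q = Ideal.span (Set.range x) ∧
    IsStandardSeq R x M

/-- `M` is Buchsbaum: every parameter ideal for `M` is standard. -/
def IsBuchsbaum (M : Type) [AddCommGroup M] [Module R M] (r : ℕ) : Prop :=
  ∀ Q : Ideal R, IsParamIdeal R Q M r → IsStandardParamIdeal R Q M r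

/-- `M` is a Vasconcelos module. -/
def IsVasconcelos (M : Type) [AddCommGroup M] [Module R M] : Prop :=
  mDim R M ≤ 0 ∨ (0 < mDim R M ∧ ∃ (r : ℕ) (Q : Ideal R) (e : ℕ → ℤ),
    mDim R M = (r : ℕ∞) ∧ IsParamIdeal R Q M r ∧ HasHilbCoeffs R Q M r e ∧ e 1 = 0)

/-- A Gorenstein local ring: Noetherian, Cohen–Macaulay, with an irreducible parameter ideal. -/
def IsGorensteinLocalRing : Prop :=
  IsNoetherianRing R ∧ IsCM R R ∧ ∃ (r : ℕ) (Q : Ideal R),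
    mDim R R = (r : ℕ∞) ∧ IsParamIdeal R Q R r ∧
    ∀ I J : Ideal R, Q = I ⊓ J → Q = I ∨ Q = J

/-- `E` is an injective envelope of the residue field `R/𝔪`. -/
def IsInjEnvResidue (E : Type) [AddCommGroup E] [Module R E] : Prop :=
  Module.Injective R E ∧ ∃ ι : (R ⧸ maximalIdeal R) →ₗ[R] E, Function.Injective ι ∧
    ∀ N : Submodule R E, N ⊓ LinearMap.range ι = ⊥ → N = ⊥

end Defs

/-- A (not necessarily local) Cohen–Macaulay ring: Noetherian,
with all localizations at primes Cohen–Macaulay. -/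
def IsCMRing (S : Type) [CommRing S] : Prop :=
  IsNoetherianRing S ∧ ∀ (p : Ideal S) [p.IsPrime],
    IsCM (Localization.AtPrime p) (Localization.AtPrime p)

/-- A (not necessarily local) Gorenstein ring. -/
def IsGorensteinRing (S : Type) [CommRing S] : Prop :=
  IsNoetherianRing S ∧ ∀ (p : Ideal S) [p.IsPrime],
    IsGorensteinLocalRing (Localization.AtPrime p)

/-- `HDegRel R I E M v` : `v` is the homological degree `hdeg_I(M)` computed
with Matlis duals taken relative to `E`. -/
inductive HDegRel (R : Type) [CommRing R] [IsLocalRing R] (I : Ideal R)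
    (E : Type) [AddCommGroup E] [Module R E] : ModuleCat R → ℕ → Prop where
  | base : ∀ (M : ModuleCat R) (l : ℕ), mDim R M ≤ 0 → mLength R M = (l : ℕ∞) →
      HDegRel R I E M l
  | step : ∀ (M : ModuleCat R) (r : ℕ), mDim R M = (r : ℕ∞) → 0 < r →
      ∀ (e : ℕ → ℤ) (e0 : ℕ), HasHilbCoeffs R I M r e → e 0 = (e0 : ℤ) →
      ∀ v : ℕ → ℕ,
        (∀ j < r, HDegRel R I E (ModuleCat.of R ((LC R j M) →ₗ[R] E)) (v j)) →
      HDegRel R I E M (e0 + ∑ j ∈ Finset.range r, (r - 1).choose j * v j)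

open scoped Pointwise

set_option linter.unusedSectionVars false

namespace HilbertVanishing

section Colength

variable {R : Type*} [CommRing R] {M N : Type*} [AddCommGroup M] [Module R M]
  [AddCommGroup N] [Module R N]

/-- The submodule has finite colength. -/
def FinCol (A : Submodule R M) : Prop := Module.length R (M ⧸ A) ≠ ⊤

/-- The colength of a submodule, with junk value `0` when infinite. -/
noncomputable def cl (A : Submodule R M) : ℕ := (Module.length R (M ⧸ A)).toNat

theorem length_comap (f : M →ₗ[R] N) (B : Submodule R N) :
    Module.length R (M ⧸ B.comap f) + Module.length R (N ⧸ (LinearMap.range f ⊔ B)) =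
      Module.length R (N ⧸ B) := by
  have hle : B ≤ LinearMap.range f ⊔ B := le_sup_right
  refine (Module.length_eq_add_of_exact (Submodule.mapQ (B.comap f) B f le_rfl)
    (Submodule.factor hle) ?_ (Submodule.factor_surjective hle) ?_).symm
  · rw [← LinearMap.ker_eq_bot, Submodule.ker_mapQ]
    simp
  · rw [LinearMap.exact_iff, Submodule.range_mapQ, Submodule.factor]
    rw [Submodule.ker_mapQ]
    simp [Submodule.map_sup]

theorem FinCol.coe {A : Submodule R M} (h : FinCol A) :
    ((cl A : ℕ) : ℕ∞) = Module.length R (M ⧸ A) := ENat.natCast_toNat h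

theorem finCol_comap {f : M →ₗ[R] N} {B : Submodule R N} (h : FinCol B) :
    FinCol (B.comap f) := by
  have := length_comap f B
  intro h'
  rw [h', top_add] at this
  exact h this.symm

theorem FinCol.mono {A B : Submodule R M} (h : FinCol A) (hAB : A ≤ B) : FinCol B := by
  have := length_comap B.subtype A
  intro h'
  rw [Submodule.range_subtype, sup_eq_left.2 hAB, h', add_top] at this
  exact h this.symm

theorem finCol_of_comap {f : M →ₗ[R] N} {B : Submodule R N} (h : FinCol (B.comap f))
    (h' : FinCol (LinearMap.range f ⊔ B)) : FinCol B := by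
  unfold FinCol at *
  rw [← length_comap f B]
  simp [h, h']

theorem cl_comap (f : M →ₗ[R] N) {B : Submodule R N} (h : FinCol B) :
    cl (B.comap f) + cl (LinearMap.range f ⊔ B) = cl B := by
  have := length_comap f B
  rw [← h.coe, ← (finCol_comap h).coe, ← (h.mono le_sup_right).coe] at this
  exact_mod_cast this

theorem cl_comap_of_surjective {f : M →ₗ[R] N} (hf : Function.Surjective f)
    (B : Submodule R N) : cl (B.comap f) = cl B := by
  have := length_comap f B
  rw [LinearMap.range_eq_top.2 hf, top_sup_eq] at this
  simp only [cl]
  rw [← this]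
  have : Module.length R (N ⧸ (⊤ : Submodule R N)) = 0 := Module.length_eq_zero
  rw [this, add_zero]

theorem finCol_of_comap_surjective {f : M →ₗ[R] N} (hf : Function.Surjective f)
    {B : Submodule R N} (h : FinCol (B.comap f)) : FinCol B := by
  refine finCol_of_comap h ?_
  rw [LinearMap.range_eq_top.2 hf, top_sup_eq]
  unfold FinCol
  rw [Module.length_eq_zero]
  simp

theorem finCol_top : FinCol (⊤ : Submodule R M) := by
  unfold FinCol
  rw [Module.length_eq_zero]
  simp

theorem cl_top : cl (⊤ : Submodule R M) = 0 := by
  unfold cl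
  rw [Module.length_eq_zero]
  simp

theorem cl_relative {A B : Submodule R M} (h : FinCol A) (hAB : A ≤ B) :
    cl (A.comap B.subtype) + cl B = cl A := by
  have := cl_comap B.subtype h
  rwa [Submodule.range_subtype, sup_eq_left.2 hAB] at this

theorem cl_mono {A B : Submodule R M} (h : FinCol A) (hAB : A ≤ B) : cl B ≤ cl A := by
  rw [← cl_relative h hAB]
  exact Nat.le_add_left _ _

theorem FinCol.inf {A B : Submodule R M} (hA : FinCol A) (hB : FinCol B) :
    FinCol (A ⊓ B) := by
  refine finCol_of_comap (f := A.subtype) ?_ ?_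
  · rw [Submodule.comap_inf, Submodule.comap_subtype_self, top_inf_eq]
    exact finCol_comap hB
  · rw [Submodule.range_subtype]
    exact hA.mono le_sup_left

theorem cl_modular {A B : Submodule R M} (hA : FinCol A) (hB : FinCol B) :
    cl (A ⊓ B) + cl (A ⊔ B) = cl A + cl B := by
  have h1 := cl_comap A.subtype hB
  have h2 := cl_relative (hA.inf hB) (inf_le_left)
  rw [Submodule.comap_inf, Submodule.comap_subtype_self, top_inf_eq] at h2
  rw [Submodule.range_subtype] at h1
  omega

theorem eq_of_cl_le {A B : Submodule R M} (h : FinCol A) (hAB : A ≤ B) (hc : cl A ≤ cl B) :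
    A = B := by
  have h1 := cl_relative h hAB
  have h2 : cl (A.comap B.subtype) = 0 := by omega
  have h3 := (finCol_comap (f := B.subtype) h).coe
  rw [h2, Nat.cast_zero, eq_comm, Module.length_eq_zero_iff, Submodule.Quotient.subsingleton_iff,
    Submodule.comap_subtype_eq_top] at h3
  exact le_antisymm hAB h3

theorem finCol_pi {ι : Type*} [Fintype ι] {A : Submodule R M} (h : FinCol A) :
    FinCol (Submodule.pi Set.univ (fun _ : ι => A)) := by
  have hb : FinCol (⊥ : Submodule R (ι → M ⧸ A)) := by
    unfold FinCol
    rw [(Submodule.quotEquivOfEqBot (⊥ : Submodule R (ι → M ⧸ A)) rfl).length_eq,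
      Module.length_pi_of_fintype]
    exact WithTop.sum_ne_top.2 fun _ _ => h
  have := finCol_comap (f := LinearMap.pi fun i : ι => A.mkQ.comp (LinearMap.proj i)) hb
  refine this.mono ?_
  intro v hv i _
  have := congrFun ((Submodule.mem_bot R).1 (Submodule.mem_comap.1 hv)) i
  simpa using this

theorem FinCol.smul_of_fg {I : Ideal R} (hI : I.FG) (h : FinCol (I • (⊤ : Submodule R M)))
    {A : Submodule R M} (hA : FinCol A) : FinCol (I • A) := by
  obtain ⟨k, x, rfl⟩ := Submodule.fg_iff_exists_fin_generating_family.1 hI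
  let φ : (Fin k → M) →ₗ[R] M := ∑ i, x i • LinearMap.proj i
  have hφ : ∀ v, φ v = ∑ i, x i • v i := fun v => by simp [φ]
  refine finCol_of_comap (f := φ) ((finCol_pi hA).mono ?_) (h.mono ?_)
  · intro v hv
    rw [Submodule.mem_comap, hφ]
    exact Submodule.sum_mem _ fun i _ => Submodule.smul_mem_smul
      (Submodule.subset_span ⟨i, rfl⟩) (hv i trivial)
  · refine le_trans ?_ le_sup_left
    rw [Submodule.smul_le]
    intro r hr n _
    induction hr using Submodule.span_induction with
    | mem r hr =>
      obtain ⟨i, rfl⟩ := hr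
      refine ⟨Pi.single i n, ?_⟩
      rw [hφ, Finset.sum_eq_single i]
      · simp
      · intro j _ hj; simp [hj]
      · simp
    | zero => simp
    | add a b _ _ ha hb => rw [add_smul]; exact Submodule.add_mem _ ha hb
    | smul a b _ hb => rw [smul_assoc]; exact Submodule.smul_mem _ _ hb

theorem FinCol.ideal_smul_top [Module.Finite R M] {I : Ideal R}
    (h : FinCol (I : Submodule R R)) : FinCol (I • (⊤ : Submodule R M)) := by
  obtain ⟨k, φ, hφ⟩ := Module.Finite.exists_fin' R M
  refine finCol_of_comap_surjective hφ ((finCol_pi h).mono ?_)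
  intro v hv
  rw [Submodule.mem_comap, ← Finset.univ_sum_single v, map_sum]
  refine Submodule.sum_mem _ fun i _ => ?_
  have : (Pi.single i (v i) : Fin k → R) = v i • Pi.single i 1 := by
    rw [← Pi.single_smul, smul_eq_mul, mul_one]
  rw [this, map_smul]
  exact Submodule.smul_mem_smul (hv i trivial) trivial

theorem FinCol.pow_smul [IsNoetherianRing R] {I : Ideal R}
    (h : FinCol (I • (⊤ : Submodule R M))) {A : Submodule R M} (hA : FinCol A) (n : ℕ) :
    FinCol (I ^ n • A) := by
  induction n with
  | zero => simpa using hA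
  | succ n ih =>
    have e : I ^ (n + 1) • A = I • I ^ n • A := by rw [pow_succ', Submodule.mul_smul]
    rw [e]
    exact h.smul_of_fg (IsNoetherian.noetherian I) ih

theorem FinCol.pow_smul_top [IsNoetherianRing R] {I : Ideal R}
    (h : FinCol (I • (⊤ : Submodule R M))) (n : ℕ) : FinCol (I ^ n • (⊤ : Submodule R M)) :=
  h.pow_smul finCol_top n

theorem finCol_maximalIdeal_smul [IsLocalRing R] [Module.Finite R M] :
    FinCol (maximalIdeal R • (⊤ : Submodule R M)) := by
  refine FinCol.ideal_smul_top ?_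
  unfold FinCol
  have : IsSimpleModule R (R ⧸ maximalIdeal R) :=
    isSimpleModule_iff_isCoatom.2 (Ideal.isMaximal_def.1 inferInstance)
  rw [Module.length_eq_one]
  simp

theorem finCol_pow_maximalIdeal_smul [IsLocalRing R] [IsNoetherianRing R] [Module.Finite R M]
    (n : ℕ) : FinCol (maximalIdeal R ^ n • (⊤ : Submodule R M)) :=
  finCol_maximalIdeal_smul.pow_smul_top n

/-- A uniform Artin–Rees estimate for a linear map. -/
theorem exists_comap_le [IsNoetherianRing R] [Module.Finite R N] (I : Ideal R)
    (f : M →ₗ[R] N) (hf : Function.Injective f) :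
    ∃ c, ∀ n, Submodule.comap f (I ^ n • ⊤) ≤ I ^ (n - c) • ⊤ := by
  obtain ⟨c, hc⟩ := Ideal.exists_pow_inf_eq_pow_smul I (LinearMap.range f)
  refine ⟨c, fun n => ?_⟩
  rcases le_total c n with h | h
  · intro y hy
    have : f y ∈ I ^ (n - c) • (I ^ c • ⊤ ⊓ LinearMap.range f) := by
      rw [← hc n h]
      exact ⟨hy, y, rfl⟩
    have h2 : I ^ (n - c) • (I ^ c • ⊤ ⊓ LinearMap.range f) ≤
        Submodule.map f (I ^ (n - c) • ⊤) := by
      rw [Submodule.map_smul'', Submodule.map_top]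
      exact Submodule.smul_mono le_rfl inf_le_right
    obtain ⟨z, hz, hzy⟩ := h2 this
    rwa [← hf hzy]
  · simp [Nat.sub_eq_zero_of_le h]

end Colength

section Counting

/-- `f n = O(n ^ (d - k))`, without truncated exponents. -/
def Growth (k d : ℕ) (f : ℕ → ℕ) : Prop :=
  ∃ C, ∀ n, f n * (n + 1) ^ k ≤ C * (n + 1) ^ d

theorem Growth.mono {k d : ℕ} {f g : ℕ → ℕ} (h : Growth k d g) (hfg : ∀ n, f n ≤ g n) :
    Growth k d f := by
  obtain ⟨C, hC⟩ := h
  exact ⟨C, fun n => (Nat.mul_le_mul_right _ (hfg n)).trans (hC n)⟩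

theorem Growth.add {k d : ℕ} {f g : ℕ → ℕ} (hf : Growth k d f) (hg : Growth k d g) :
    Growth k d (fun n => f n + g n) := by
  obtain ⟨C, hC⟩ := hf
  obtain ⟨D, hD⟩ := hg
  exact ⟨C + D, fun n => by rw [add_mul, add_mul]; exact add_le_add (hC n) (hD n)⟩

theorem Growth.const_mul {k d : ℕ} {f : ℕ → ℕ} (hf : Growth k d f) (c : ℕ) :
    Growth k d (fun n => c * f n) := by
  obtain ⟨C, hC⟩ := hf
  exact ⟨c * C, fun n => by rw [mul_assoc, mul_assoc]; exact Nat.mul_le_mul_left _ (hC n)⟩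

theorem Growth.zero (k d : ℕ) : Growth k d (fun _ => 0) := ⟨0, by simp⟩

theorem Growth.of_succ {k d : ℕ} {f : ℕ → ℕ} (hf : Growth (k + 1) d f) : Growth k d f := by
  obtain ⟨C, hC⟩ := hf
  refine ⟨C, fun n => (Nat.mul_le_mul_left _ ?_).trans (hC n)⟩
  exact Nat.pow_le_pow_right (Nat.succ_pos n) (Nat.le_succ k)

theorem Growth.succ_right {k d : ℕ} {f : ℕ → ℕ} (hf : Growth k d f) : Growth k (d + 1) f := by
  obtain ⟨C, hC⟩ := hf
  refine ⟨C, fun n => (hC n).trans (Nat.mul_le_mul_left _ ?_)⟩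
  exact Nat.pow_le_pow_right (Nat.succ_pos n) (Nat.le_succ d)

theorem Growth.shift {k d : ℕ} {f g : ℕ → ℕ} (hf : Growth k d f) (c : ℕ)
    (h : ∀ n, g n ≤ f (n + c)) : Growth k d g := by
  obtain ⟨C, hC⟩ := hf
  refine ⟨C * (c + 1) ^ d, fun n => ?_⟩
  calc g n * (n + 1) ^ k ≤ f (n + c) * (n + c + 1) ^ k :=
        Nat.mul_le_mul (h n) (Nat.pow_le_pow_left (by omega) k)
    _ ≤ C * (n + c + 1) ^ d := hC _
    _ ≤ C * ((c + 1) * (n + 1)) ^ d :=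
        Nat.mul_le_mul_left _ (Nat.pow_le_pow_left (by nlinarith) d)
    _ = _ := by rw [mul_pow]; ring

/-- A function eventually dominated by one of given growth has that growth. -/
theorem Growth.of_eventually {k d : ℕ} (hkd : k ≤ d) {f : ℕ → ℕ} {C N : ℕ}
    (h : ∀ n ≥ N, f n * (n + 1) ^ k ≤ C * (n + 1) ^ d) : Growth k d f := by
  refine ⟨C + ∑ i ∈ Finset.range N, f i, fun n => ?_⟩
  rcases lt_or_ge n N with hn | hn
  · refine Nat.mul_le_mul ?_ (Nat.pow_le_pow_right (Nat.succ_pos n) hkd)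
    exact (Finset.single_le_sum (f := f) (fun _ _ => Nat.zero_le _)
      (Finset.mem_range.2 hn)).trans (Nat.le_add_left _ _)
  · exact (h n hn).trans (Nat.mul_le_mul_right _ (Nat.le_add_right _ _))

/-- A nondecreasing function grows one order slower than its partial sums. -/
theorem Growth.of_sum {k d : ℕ} {f : ℕ → ℕ} (hf : Monotone f)
    (h : Growth k (d + 1) fun N => ∑ n ∈ Finset.range (N + 1), f n) : Growth k d f := by
  obtain ⟨C, hC⟩ := h
  refine ⟨C * 2 ^ (d + 1), fun N => ?_⟩
  have h1 : (N + 1) * f N ≤ ∑ n ∈ Finset.range (2 * N + 1), f n := by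
    calc (N + 1) * f N = ∑ n ∈ Finset.Ico N (2 * N + 1), f N := by
          rw [Finset.sum_const, Nat.card_Ico, smul_eq_mul]; congr 1; omega
      _ ≤ ∑ n ∈ Finset.Ico N (2 * N + 1), f n :=
          Finset.sum_le_sum fun i hi => hf (Finset.mem_Ico.1 hi).1
      _ ≤ _ := Finset.sum_le_sum_of_subset (by
          intro i hi; rw [Finset.mem_range]; exact (Finset.mem_Ico.1 hi).2)
  have h2 : (N + 1) * f N * (N + 1) ^ k ≤ C * (2 * (N + 1)) ^ (d + 1) := by
    refine (Nat.mul_le_mul h1 (Nat.pow_le_pow_left (by omega) k)).trans ((hC (2 * N)).trans ?_)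
    exact Nat.mul_le_mul_left _ (Nat.pow_le_pow_left (by omega) _)
  refine Nat.le_of_mul_le_mul_left ?_ (Nat.succ_pos N)
  calc (N + 1) * (f N * (N + 1) ^ k) = (N + 1) * f N * (N + 1) ^ k := by ring
    _ ≤ _ := h2
    _ = _ := by rw [mul_pow, pow_succ (N + 1), Nat.succ_eq_add_one]; ring

theorem Growth.eq_zero_of_monotone {k : ℕ} {f : ℕ → ℕ} (hf : Monotone f)
    (h : Growth (k + 1) k f) (n : ℕ) : f n = 0 := by
  obtain ⟨C, hC⟩ := h
  by_contra hn
  have h1 := hC (n + C)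
  rw [pow_succ', ← mul_assoc] at h1
  have h2 := Nat.le_of_mul_le_mul_right h1 (by positivity)
  have h3 := hf (Nat.le_add_right n C)
  nlinarith [Nat.pos_of_ne_zero hn]

theorem multichoose_succ_eq_sum (d n : ℕ) :
    Nat.multichoose (d + 1) n = ∑ j ∈ Finset.range (n + 1), Nat.multichoose d j := by
  induction n with
  | zero => simp
  | succ n ih => rw [Finset.sum_range_succ, ← ih, Nat.multichoose_succ_succ, add_comm]

theorem multichoose_mono {d : ℕ} (hd : d ≠ 0) : Monotone (Nat.multichoose d) := by
  obtain ⟨d, rfl⟩ := Nat.exists_eq_succ_of_ne_zero hd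
  refine monotone_nat_of_le_succ fun n => ?_
  rw [Nat.multichoose_succ_succ]
  exact Nat.le_add_left _ _

theorem multichoose_succ_le_pow (d n : ℕ) : Nat.multichoose (d + 1) n ≤ (n + 1) ^ d := by
  induction d with
  | zero => simp
  | succ d ih =>
    rw [multichoose_succ_eq_sum, pow_succ]
    calc _ ≤ ∑ j ∈ Finset.range (n + 1), (n + 1) ^ d := by
          refine Finset.sum_le_sum fun j hj => ?_
          exact (multichoose_mono (Nat.succ_ne_zero d)
            (Nat.lt_succ_iff.1 (Finset.mem_range.1 hj))).trans ih
      _ = _ := by simp [mul_comm]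

theorem multichoose_mul_le_pow (d n : ℕ) : Nat.multichoose d n * (n + 1) ≤ (n + 1) ^ d := by
  rcases d with _ | d
  · rcases n with _ | n <;> simp
  · rw [pow_succ]
    exact Nat.mul_le_mul_right _ (multichoose_succ_le_pow d n)

theorem growth_multichoose (d : ℕ) : Growth 1 d (Nat.multichoose d) :=
  ⟨1, fun n => by simpa using multichoose_mul_le_pow d n⟩

theorem pow_le_factorial_mul_multichoose (d n : ℕ) :
    (n + 1) ^ d ≤ d.factorial * Nat.multichoose (d + 1) n := by
  rw [Nat.multichoose_eq, show d + 1 + n - 1 = n + d by omega]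
  rw [show (n + d).choose n = (n + d).choose d by
    rw [← Nat.choose_symm_add], ← Nat.ascFactorial_eq_factorial_mul_choose]
  exact Nat.pow_succ_le_ascFactorial (n + 1) d

theorem le_of_multichoose_le {d e e' : ℕ} {f : ℕ → ℕ} (hf : Growth 1 d f)
    (h : ∀ n, e * Nat.multichoose (d + 1) n ≤ e' * Nat.multichoose (d + 1) n + f n) :
    e ≤ e' := by
  obtain ⟨C, hC⟩ := hf
  by_contra! hlt
  have key : ∀ n, n + 1 ≤ d.factorial * C := by
    intro n
    have h1 : Nat.multichoose (d + 1) n ≤ f n := by nlinarith [h n]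
    have h2 := pow_le_factorial_mul_multichoose d n
    have h3 := hC n
    rw [pow_one] at h3
    have h4 : (n + 1) * (n + 1) ^ d ≤ d.factorial * C * (n + 1) ^ d := by
      calc (n + 1) * (n + 1) ^ d ≤ (n + 1) * (d.factorial * f n) :=
            Nat.mul_le_mul_left _ (h2.trans (Nat.mul_le_mul_left _ h1))
        _ = d.factorial * (f n * (n + 1)) := by ring
        _ ≤ d.factorial * (C * (n + 1) ^ d) := Nat.mul_le_mul_left _ h3
        _ = _ := by ring
    exact Nat.le_of_mul_le_mul_right h4 (by positivity)
  have := key (d.factorial * C)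
  omega

theorem sum_range_le_shift {f : ℕ → ℕ} (hf : Monotone f) (s N : ℕ) :
    ∑ n ∈ Finset.range (N + 1), f n ≤ ∑ n ∈ Finset.range (N + 1 - s), f n + s * f N := by
  induction s with
  | zero => simp
  | succ s ih =>
    refine ih.trans ?_
    have : ∑ n ∈ Finset.range (N + 1 - s), f n ≤
        ∑ n ∈ Finset.range (N + 1 - (s + 1)), f n + f N := by
      rcases Nat.lt_or_ge s (N + 1) with h | h
      · rw [show N + 1 - s = (N + 1 - (s + 1)) + 1 by omega, Finset.sum_range_succ]
        exact Nat.add_le_add_left (hf (by omega)) _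
      · rw [Nat.sub_eq_zero_of_le h]; simp
    rw [add_mul, one_mul]
    omega

theorem growth_sum_of_shift {d s : ℕ} (hs : 0 < Nat.multichoose d s) {h : ℕ → ℕ}
    (h1 : ∀ n, h n ≤ Nat.multichoose d n)
    (h2 : ∀ n, h (n + s) + Nat.multichoose d n ≤ Nat.multichoose d (n + s)) :
    Growth 1 d fun N => ∑ n ∈ Finset.range (N + 1), h n := by
  rcases Nat.eq_zero_or_pos d with rfl | hd
  · rcases s with _ | s
    · refine (Growth.zero 1 0).mono fun N => ?_
      rw [Nat.le_zero]
      exact Finset.sum_eq_zero fun n _ => by have := h2 n; simp at this; exact this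
    · simp at hs
  have hmono := multichoose_mono hd.ne'
  refine ((growth_multichoose d).const_mul s).mono fun N => ?_
  have key := sum_range_le_shift hmono s N
  have h3 : ∑ n ∈ Finset.range (N + 1), h n + ∑ n ∈ Finset.range (N + 1 - s), Nat.multichoose d n
      ≤ ∑ n ∈ Finset.range (N + 1), Nat.multichoose d n := by
    generalize N + 1 = K
    rcases le_total s K with hs' | hs'
    · obtain ⟨L, rfl⟩ := Nat.exists_eq_add_of_le hs'
      rw [Finset.sum_range_add, Finset.sum_range_add, Nat.add_sub_cancel_left, add_assoc,
        ← Finset.sum_add_distrib]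
      refine add_le_add (Finset.sum_le_sum fun i _ => h1 i) (Finset.sum_le_sum fun i _ => ?_)
      rw [add_comm s i]; exact h2 i
    · rw [Nat.sub_eq_zero_of_le hs', Finset.sum_range_zero, add_zero]
      exact Finset.sum_le_sum fun i _ => h1 i
  omega

end Counting

section Forms

variable {R : Type*} [CommRing R] [IsLocalRing R] {d : ℕ}

/-- Forms of degree `n` in `d` variables. -/
abbrev Forms (R : Type*) [CommRing R] (d n : ℕ) : Submodule R (MvPolynomial (Fin d) R) :=
  MvPolynomial.homogeneousSubmodule (Fin d) R n

/-- Reduction of the coefficients of a form to the residue field. -/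
noncomputable def formResidue (R : Type*) [CommRing R] [IsLocalRing R] (d n : ℕ) :
    Forms R d n →ₗ[R] ((Finset.univ : Finset (Fin d)).finsuppAntidiag n → ResidueField R) :=
  LinearMap.pi fun s => (Algebra.linearMap R (ResidueField R)).comp
    ((MvPolynomial.lcoeff R s.1).comp (Forms R d n).subtype)

theorem formResidue_apply (n : ℕ) (f : Forms R d n)
    (s : (Finset.univ : Finset (Fin d)).finsuppAntidiag n) :
    formResidue R d n f s = residue R (f.1.coeff s.1) := rfl

theorem mem_univ_finsuppAntidiag {n : ℕ} {s : Fin d →₀ ℕ} :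
    s ∈ (Finset.univ : Finset (Fin d)).finsuppAntidiag n ↔ s.degree = n := by
  rw [Finset.mem_finsuppAntidiag, Finsupp.degree_eq_sum]
  simp

theorem formResidue_surjective (n : ℕ) : Function.Surjective (formResidue R d n) := by
  intro v
  choose w hw using fun s => residue_surjective (R := R) (v s)
  refine ⟨⟨∑ s, MvPolynomial.monomial s.1 (w s), Submodule.sum_mem _ fun s _ =>
    MvPolynomial.isHomogeneous_monomial _ (mem_univ_finsuppAntidiag.1 s.2)⟩, ?_⟩
  funext s
  rw [formResidue_apply, ← hw s]
  congr 1
  simp only [MvPolynomial.coeff_sum, MvPolynomial.coeff_monomial]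
  rw [Finset.sum_eq_single s]
  · simp
  · intro t _ ht
    rw [if_neg]
    exact fun h => ht (Subtype.ext h)
  · simp

theorem length_residueField : Module.length R (ResidueField R) = 1 := by
  have : IsSimpleModule R (ResidueField R) :=
    (isSimpleModule_iff_isCoatom (m := maximalIdeal R)).2
      (Ideal.isMaximal_def.1 inferInstance)
  exact Module.length_eq_one R _

theorem length_quot_ker_formResidue (n : ℕ) :
    Module.length R (Forms R d n ⧸ LinearMap.ker (formResidue R d n)) =
      (Nat.multichoose d n : ℕ) := by
  rw [((formResidue R d n).quotKerEquivOfSurjective (formResidue_surjective n)).length_eq,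
    Module.length_pi_of_fintype]
  simp only [length_residueField]
  simp [Finset.card_finsuppAntidiag_nat_eq_multichoose]

theorem finCol_ker_formResidue (n : ℕ) : FinCol (LinearMap.ker (formResidue R d n)) := by
  unfold FinCol
  rw [length_quot_ker_formResidue]
  exact ENat.natCast_ne_top _

theorem cl_ker_formResidue (n : ℕ) :
    cl (LinearMap.ker (formResidue R d n)) = Nat.multichoose d n := by
  unfold cl
  rw [length_quot_ker_formResidue]
  rfl

theorem mem_ker_formResidue {n : ℕ} {f : Forms R d n} :
    f ∈ LinearMap.ker (formResidue R d n) ↔ MvPolynomial.map (residue R) f.1 = 0 := by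
  rw [LinearMap.mem_ker]
  constructor
  · intro h
    ext s
    rw [MvPolynomial.coeff_map, MvPolynomial.coeff_zero]
    by_cases hs : s.degree = n
    · exact congrFun h ⟨s, mem_univ_finsuppAntidiag.2 hs⟩
    · rw [MvPolynomial.IsHomogeneous.coeff_eq_zero f.2 hs, map_zero]
  · intro h
    funext s
    rw [formResidue_apply, ← MvPolynomial.coeff_map, h]
    simp

theorem multichoose_pos_of_form {n : ℕ} {f : Forms R d n}
    (hf : f ∉ LinearMap.ker (formResidue R d n)) : 0 < Nat.multichoose d n := by
  rw [Nat.pos_iff_ne_zero]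
  intro h
  have h1 := length_quot_ker_formResidue (R := R) (d := d) n
  rw [h, Nat.cast_zero, Module.length_eq_zero_iff, Submodule.Quotient.subsingleton_iff] at h1
  exact hf (h1 ▸ trivial)

/-- Multiplication by a form. -/
noncomputable def formMul {s : ℕ} (f : Forms R d s) (n : ℕ) : Forms R d n →ₗ[R] Forms R d (n + s) :=
  ((LinearMap.mulRight R f.1).comp (Forms R d n).subtype).codRestrict _
    fun p => MvPolynomial.IsHomogeneous.mul p.2 f.2

theorem comap_formMul {s : ℕ} {f : Forms R d s} (hf : f ∉ LinearMap.ker (formResidue R d s))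
    (n : ℕ) : (LinearMap.ker (formResidue R d (n + s))).comap (formMul f n) =
      LinearMap.ker (formResidue R d n) := by
  ext p
  rw [Submodule.mem_comap, mem_ker_formResidue, mem_ker_formResidue]
  rw [mem_ker_formResidue] at hf
  have : (formMul f n p).1 = p.1 * f.1 := rfl
  rw [this, map_mul, mul_eq_zero, or_iff_left hf]

variable {M : Type*} [AddCommGroup M] [Module R M]

/-- Substitution of `x` into a form, acting on `g`. -/
noncomputable def formEval (x : Fin d → R) (g : M) (n : ℕ) : Forms R d n →ₗ[R] M :=
  (LinearMap.toSpanSingleton R M g).comp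
    ((MvPolynomial.aeval x).toLinearMap.comp (Forms R d n).subtype)

omit [IsLocalRing R] in
theorem formEval_apply (x : Fin d → R) (g : M) (n : ℕ) (f : Forms R d n) :
    formEval x g n f = MvPolynomial.eval x f.1 • g := by
  simp [formEval, MvPolynomial.aeval_eq_eval]

omit [IsLocalRing R] in
theorem range_formEval (x : Fin d → R) (g : M) (n : ℕ) :
    LinearMap.range (formEval x g n) =
      Ideal.span (Set.range x) ^ n • Submodule.span R {g} := by
  ext y
  rw [LinearMap.mem_range, Submodule.mem_smul_span_singleton]
  constructor
  · rintro ⟨f, rfl⟩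
    exact ⟨_, (Ideal.mem_span_pow_iff_exists_isHomogeneous x _).2 ⟨f.1, f.2, rfl⟩,
      (formEval_apply x g n f).symm⟩
  · rintro ⟨r, hr, rfl⟩
    obtain ⟨p, hp, rfl⟩ := (Ideal.mem_span_pow_iff_exists_isHomogeneous x _).1 hr
    exact ⟨⟨p, hp⟩, formEval_apply x g n _⟩

theorem ker_formResidue_le {x : Fin d → R} {g : M} {A : Submodule R M}
    (hg : ∀ r ∈ maximalIdeal R, r • g ∈ A) (n : ℕ) :
    LinearMap.ker (formResidue R d n) ≤
      (Ideal.span (Set.range x) ^ n • A).comap (formEval x g n) := by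
  intro f hf
  rw [Submodule.mem_comap, formEval_apply, MvPolynomial.eval_eq, Finset.sum_smul]
  refine Submodule.sum_mem _ fun s hs => ?_
  rw [mul_comm, mul_smul]
  have hdeg : s.degree = n := by
    by_contra h
    exact MvPolynomial.mem_support_iff.1 hs (MvPolynomial.IsHomogeneous.coeff_eq_zero f.2 h)
  refine Submodule.smul_mem_smul ?_ (hg _ ?_)
  · refine (Ideal.mem_span_pow_iff_exists_isHomogeneous x _).2
      ⟨MvPolynomial.monomial s 1, MvPolynomial.isHomogeneous_monomial _ hdeg, ?_⟩
    rw [MvPolynomial.eval_monomial, one_mul, Finsupp.prod]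
  · rw [← residue_eq_zero_iff]
    exact congrFun (LinearMap.mem_ker.1 hf) ⟨s, mem_univ_finsuppAntidiag.2 hdeg⟩

/-- The Hilbert function of `Q`-powers along a simple extension `A ≤ B` is either that of a
polynomial ring over the residue field, or of smaller order. -/
theorem hilbert_simple_extension (x : Fin d → R)
    {A B : Submodule R M} {g : M} (hAB : B = A ⊔ Submodule.span R {g})
    (hg : ∀ r ∈ maximalIdeal R, r • g ∈ A)
    (hA : ∀ n, FinCol (Ideal.span (Set.range x) ^ n • A)) :
    ∃ h : ℕ → ℕ,
      (∀ n, cl (Ideal.span (Set.range x) ^ n • A) = cl (Ideal.span (Set.range x) ^ n • B) + h n) ∧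
      (∀ n, h n ≤ Nat.multichoose d n) ∧
      (((∀ n, h n = Nat.multichoose d n) ∧
        ∀ n i, ∀ y ∈ Ideal.span (Set.range x) ^ n • B,
          x i • y ∈ Ideal.span (Set.range x) ^ (n + 1) • A →
          y ∈ Ideal.span (Set.range x) ^ n • A) ∨
      Growth 1 d fun N => ∑ n ∈ Finset.range (N + 1), h n) := by
  set Q := Ideal.span (Set.range x) with hQ
  let K : ∀ n, Submodule R (Forms R d n) := fun n => (Q ^ n • A).comap (formEval x g n)
  have hK : ∀ n, LinearMap.ker (formResidue R d n) ≤ K n := ker_formResidue_le hg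
  have hQB : ∀ n, LinearMap.range (formEval x g n) ⊔ Q ^ n • A = Q ^ n • B := fun n => by
    rw [range_formEval, hAB, Submodule.smul_sup, sup_comm]
  refine ⟨fun n => cl (K n), fun n => ?_, fun n => ?_, ?_⟩
  · have := cl_comap (formEval x g n) (hA n)
    rw [hQB] at this
    rw [← this, add_comm]
  · rw [← cl_ker_formResidue (R := R)]
    exact cl_mono (finCol_ker_formResidue n) (hK n)
  · by_cases hcase : ∀ n, K n ≤ LinearMap.ker (formResidue R d n)
    · left
      refine ⟨fun n => (congrArg cl (le_antisymm (hcase n) (hK n))).trans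
        (cl_ker_formResidue n), ?_⟩
      intro n i y hy hxy
      rw [← hQB n] at hy
      obtain ⟨_, ⟨f, rfl⟩, a, ha, rfl⟩ := Submodule.mem_sup.1 hy
      refine Submodule.add_mem _ (hK n ?_) ha
      have hXi : MvPolynomial.X i ∈ Forms R d 1 := MvPolynomial.isHomogeneous_X R i
      have hX : (⟨_, hXi⟩ : Forms R d 1) ∉ LinearMap.ker (formResidue R d 1) := by
        rw [mem_ker_formResidue, MvPolynomial.map_X]
        exact MvPolynomial.X_ne_zero i
      rw [← comap_formMul hX]
      refine hcase (n + 1) ?_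
      change formEval x g (n + 1) _ ∈ Q ^ (n + 1) • A
      have e1 : formEval x g (n + 1) (formMul ⟨_, hXi⟩ n f) = x i • formEval x g n f := by
        rw [formEval_apply, formEval_apply]
        change MvPolynomial.eval x (f.1 * MvPolynomial.X i) • g = _
        rw [map_mul, MvPolynomial.eval_X, mul_comm, mul_smul]
      rw [e1]
      rw [smul_add] at hxy
      refine (Submodule.add_mem_iff_left _ ?_).1 hxy
      rw [pow_succ', Submodule.mul_smul]
      exact Submodule.smul_mem_smul (Ideal.subset_span ⟨i, rfl⟩) ha
    · right
      push Not at hcase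
      obtain ⟨s, hs⟩ := hcase
      obtain ⟨f, hfK, hf⟩ := Set.not_subset.1 hs
      refine growth_sum_of_shift (multichoose_pos_of_form hf) (fun n => ?_) fun n => ?_
      · rw [← cl_ker_formResidue (R := R)]
        exact cl_mono (finCol_ker_formResidue n) (hK n)
      · have h1 := cl_comap (formMul f n) (finCol_ker_formResidue (R := R) (d := d) (n + s))
        rw [comap_formMul hf, cl_ker_formResidue, cl_ker_formResidue] at h1
        rw [← h1, add_comm]
        refine Nat.add_le_add_left (cl_mono ((finCol_ker_formResidue _).mono le_sup_right) ?_) _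
        refine sup_le ?_ (hK _)
        rintro _ ⟨p, rfl⟩
        change formEval x g (n + s) _ ∈ Q ^ (n + s) • A
        rw [formEval_apply]
        change MvPolynomial.eval x (p.1 * f.1) • g ∈ _
        rw [map_mul, mul_smul, pow_add, Submodule.mul_smul]
        refine Submodule.smul_mem_smul
          ((Ideal.mem_span_pow_iff_exists_isHomogeneous x _).2 ⟨p.1, p.2, rfl⟩) ?_
        rw [← formEval_apply]
        exact hfK

end Forms

section HilbertFunction

variable {R : Type*} [CommRing R] [IsLocalRing R] [IsNoetherianRing R] {d : ℕ}
  {M : Type*} [AddCommGroup M] [Module R M]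

omit [IsNoetherianRing R] in
/-- A proper submodule of finite colength is properly contained in a cyclic extension
with quotient killed by the maximal ideal. -/
theorem exists_socle_extension {A : Submodule R M} (hA : FinCol A) (hne : A ≠ ⊤) :
    ∃ g ∉ A, ∀ r ∈ maximalIdeal R, r • g ∈ A := by
  have hfin : IsFiniteLength R (M ⧸ A) := Module.length_ne_top_iff.1 hA
  have := (isFiniteLength_iff_isNoetherian_isArtinian.1 hfin).2
  have hnt : Nontrivial (M ⧸ A) := Submodule.Quotient.nontrivial_iff.2 hne
  obtain ⟨S, hS⟩ := IsAtomic.exists_atom (Submodule R (M ⧸ A))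
  have hsimple : IsSimpleModule R S := isSimpleModule_iff_isAtom.2 hS
  obtain ⟨y, hyS, hy⟩ := S.exists_mem_ne_zero_of_ne_bot hS.1
  obtain ⟨g, rfl⟩ := A.mkQ_surjective y
  refine ⟨g, fun h => hy ((Submodule.Quotient.mk_eq_zero A).2 h), fun r hr => ?_⟩
  rw [← Submodule.Quotient.mk_eq_zero, Submodule.Quotient.mk_smul]
  have hann : maximalIdeal R • S = ⊥ := by
    rcases hS.le_iff.1 (Submodule.smul_le_right (I := maximalIdeal R) (N := S)) with h | h
    · exact h
    · have hfg : S.FG :=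
        (isFiniteLength_iff_isNoetherian_isArtinian.1 hfin).1.noetherian S
      exact Submodule.eq_bot_of_le_smul_of_le_jacobson_bot (maximalIdeal R) S hfg h.ge
        (maximalIdeal_le_jacobson _) ▸ h
  have := hann ▸ Submodule.smul_mem_smul hr hyS
  exact (Submodule.mem_bot R).1 this

/-- The comparison of the Hilbert function of a parameter ideal with its leading term. -/
theorem exists_hilbert_comparison (x : Fin d → R)
    (hQ : FinCol (Ideal.span (Set.range x) • (⊤ : Submodule R M))) :
    ∃ (e : ℕ) (τ : ℕ → ℕ),
      (∀ n, cl (Ideal.span (Set.range x) ^ (n + 1) • (⊤ : Submodule R M)) =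
        cl (Ideal.span (Set.range x) ^ n • (⊤ : Submodule R M)) +
          e * Nat.multichoose d n + τ n) ∧
      (∀ n, e * Nat.multichoose d n + τ n ≤
        cl (Ideal.span (Set.range x) • (⊤ : Submodule R M)) * Nat.multichoose d n) ∧
      Growth 1 d (fun N => ∑ n ∈ Finset.range (N + 1), τ n) ∧
      ∀ n i, cl (Ideal.span (Set.range x) ^ (n + 1) • (⊤ : Submodule R M)) ≤
        cl (Ideal.span (Set.range x) ^ n • (⊤ : Submodule R M) ⊓
          (Ideal.span (Set.range x) ^ (n + 2) • (⊤ : Submodule R M)).comap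
            (LinearMap.lsmul R M (x i))) + τ n := by
  set Q := Ideal.span (Set.range x) with hQdef
  let P : Submodule R M → Prop := fun A => ∃ (e : ℕ) (τ : ℕ → ℕ),
      (∀ n, cl (Q ^ (n + 1) • (⊤ : Submodule R M)) =
        cl (Q ^ n • A) + e * Nat.multichoose d n + τ n) ∧
      (∀ n, e * Nat.multichoose d n + τ n + cl A * Nat.multichoose d n ≤
        cl (Q • (⊤ : Submodule R M)) * Nat.multichoose d n) ∧
      Growth 1 d (fun N => ∑ n ∈ Finset.range (N + 1), τ n) ∧
      ∀ n i, cl (Q ^ (n + 1) • (⊤ : Submodule R M)) ≤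
        cl (Q ^ n • A ⊓ (Q ^ (n + 2) • (⊤ : Submodule R M)).comap
            (LinearMap.lsmul R M (x i))) + τ n
  suffices h : P ⊤ by
    obtain ⟨e, τ, h1, h2, h3, h4⟩ := h
    exact ⟨e, τ, h1, fun n => by simpa [cl_top] using h2 n, h3, h4⟩
  have hfc : ∀ A : Submodule R M, Q • ⊤ ≤ A → FinCol A := fun A h => hQ.mono h
  have hstep : ∀ k, ∀ A : Submodule R M, Q • ⊤ ≤ A → cl A = k → P A → P ⊤ := by
    intro k
    induction k using Nat.strong_induction_on with
    | _ k ih =>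
      intro A hQA hk hPA
      by_cases hA : A = ⊤
      · exact hA ▸ hPA
      obtain ⟨g, hgA, hg⟩ := exists_socle_extension (hfc A hQA) hA
      set B := A ⊔ Submodule.span R {g} with hB
      have hAB : A ≤ B := le_sup_left
      have hgB : g ∈ B := (le_sup_right : _ ≤ B) (Submodule.mem_span_singleton_self g)
      have hlt : cl B < cl A := by
        by_contra hge
        exact hgA ((eq_of_cl_le (hfc A hQA) hAB (not_lt.1 hge)) ▸ hgB)
      refine ih _ (hk ▸ hlt) B (hQA.trans hAB) rfl ?_
      obtain ⟨e, τ, h1, h2, h3, h4⟩ := hPA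
      have hfA : ∀ n, FinCol (Q ^ n • A) := fun n => hQ.pow_smul (hfc A hQA) n
      obtain ⟨h, hh1, hh2, hh3⟩ := hilbert_simple_extension x hB hg hfA
      rw [← hQdef] at hh1 hh3
      rcases hh3 with ⟨heq, hinj⟩ | hgr
      · refine ⟨e + 1, τ, fun n => ?_, fun n => ?_, h3, fun n i => ?_⟩
        · rw [h1, hh1, heq]; ring
        · have := h2 n
          have h5 : (cl B + 1) * Nat.multichoose d n ≤ cl A * Nat.multichoose d n :=
            Nat.mul_le_mul_right _ hlt
          linarith [h5, this]
        · refine (h4 n i).trans (le_of_eq ?_)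
          congr 2
          apply le_antisymm
          · exact inf_le_inf_right _ (Submodule.smul_mono le_rfl hAB)
          · rintro y ⟨hy1, hy2⟩
            refine ⟨hinj n i y hy1 ?_, hy2⟩
            have : Q ^ (n + 2) • (⊤ : Submodule R M) ≤ Q ^ (n + 1) • A := by
              rw [pow_succ Q (n + 1), Submodule.mul_smul]
              exact Submodule.smul_mono le_rfl hQA
            exact this hy2
      · refine ⟨e, fun n => τ n + h n, fun n => ?_, fun n => ?_, ?_, fun n i => ?_⟩
        · rw [h1, hh1]; ring
        · have := h2 n
          have h5 : (cl B + 1) * Nat.multichoose d n ≤ cl A * Nat.multichoose d n :=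
            Nat.mul_le_mul_right _ hlt
          linarith [h5, this, hh2 n]
        · simpa only [Finset.sum_add_distrib] using h3.add hgr
        · set D := (Q ^ (n + 2) • (⊤ : Submodule R M)).comap (LinearMap.lsmul R M (x i))
          have hfB : FinCol (Q ^ n • B ⊓ D) :=
            ((hfA n).mono (Submodule.smul_mono le_rfl hAB)).inf
              (finCol_comap (hQ.pow_smul_top (n + 2)))
          have hm := cl_modular hfB (hfA n)
          have e1 : Q ^ n • B ⊓ D ⊓ Q ^ n • A = Q ^ n • A ⊓ D := by
            rw [inf_right_comm, inf_eq_right.2 (Submodule.smul_mono le_rfl hAB)]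
          rw [e1] at hm
          have h6 : cl (Q ^ n • B) ≤ cl (Q ^ n • B ⊓ D ⊔ Q ^ n • A) :=
            cl_mono (hfB.mono le_sup_left)
              (sup_le inf_le_left (Submodule.smul_mono le_rfl hAB))
          have h7 : _ ≤ cl (Q ^ n • A ⊓ D) + τ n := h4 n i
          have := hh1 n
          change _ ≤ _ + (τ n + h n)
          omega
  refine hstep _ (Q • ⊤) le_rfl rfl ⟨0, fun _ => 0, fun n => ?_, fun n => ?_, ?_, fun n i => ?_⟩
  · rw [pow_succ, Submodule.mul_smul]; simp
  · simp
  · simpa using Growth.zero 1 d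
  · rw [add_zero, ← Submodule.mul_smul, ← pow_succ]
    exact cl_mono ((hQ.pow_smul_top (n + 1)).inf (finCol_comap (hQ.pow_smul_top (n + 2))))
      inf_le_left

end HilbertFunction

section HilbertData

variable {R : Type*} [CommRing R]

/-- The Hilbert–Samuel function `n ↦ λ(M / I ^ (n + 1) M)`. -/
noncomputable def hilb (I : Ideal R) (M : Type*) [AddCommGroup M] [Module R M] (n : ℕ) : ℕ :=
  cl (I ^ (n + 1) • (⊤ : Submodule R M))

/-- The comparison of the Hilbert function with its leading term `e`, with error terms `τ`. -/
structure HilbData (xs : List R) (M : Type*) [AddCommGroup M] [Module R M] (e : ℕ)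
    (τ : ℕ → ℕ) : Prop where
  step : ∀ n, cl (Ideal.ofList xs ^ (n + 1) • (⊤ : Submodule R M)) =
    cl (Ideal.ofList xs ^ n • (⊤ : Submodule R M)) + e * Nat.multichoose xs.length n + τ n
  bound : ∀ n, e * Nat.multichoose xs.length n + τ n ≤
    cl (Ideal.ofList xs • (⊤ : Submodule R M)) * Nat.multichoose xs.length n
  growth : Growth 1 xs.length (fun N => ∑ n ∈ Finset.range (N + 1), τ n)
  colon : ∀ n, ∀ a ∈ xs, cl (Ideal.ofList xs ^ (n + 1) • (⊤ : Submodule R M)) ≤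
    cl (Ideal.ofList xs ^ n • (⊤ : Submodule R M) ⊓
      (Ideal.ofList xs ^ (n + 2) • (⊤ : Submodule R M)).comap (LinearMap.lsmul R M a)) + τ n

/-- The Hilbert function agrees with its leading term up to order `d - 2`. -/
def Star (xs : List R) (M : Type*) [AddCommGroup M] [Module R M] : Prop :=
  ∃ (e : ℕ) (f : ℕ → ℕ),
    (∀ n, hilb (Ideal.ofList xs) M n = e * Nat.multichoose (xs.length + 1) n + f n) ∧
    Growth 2 xs.length f

variable {M : Type*} [AddCommGroup M] [Module R M]

theorem ofList_eq_span_range (xs : List R) : Ideal.ofList xs = Ideal.span (Set.range xs.get) := by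
  rw [Ideal.ofList, Set.range_list_get]

theorem exists_hilbData [IsLocalRing R] [IsNoetherianRing R] {xs : List R}
    (hQ : FinCol (Ideal.ofList xs • (⊤ : Submodule R M))) : ∃ e τ, HilbData xs M e τ := by
  rw [ofList_eq_span_range] at hQ
  obtain ⟨e, τ, h1, h2, h3, h4⟩ := exists_hilbert_comparison xs.get hQ
  rw [← ofList_eq_span_range] at h1 h2 h4
  refine ⟨e, τ, h1, h2, h3, fun n a ha => ?_⟩
  obtain ⟨i, rfl⟩ := List.get_of_mem ha
  exact h4 n i

theorem HilbData.pow_eq {xs : List R} {e : ℕ} {τ : ℕ → ℕ} (h : HilbData xs M e τ) (n : ℕ) :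
    cl (Ideal.ofList xs ^ n • (⊤ : Submodule R M)) =
      e * ∑ j ∈ Finset.range n, Nat.multichoose xs.length j + ∑ j ∈ Finset.range n, τ j := by
  induction n with
  | zero => simp [cl_top]
  | succ n ih => rw [h.step, ih, Finset.sum_range_succ, Finset.sum_range_succ]; ring

theorem HilbData.hilb_eq {xs : List R} {e : ℕ} {τ : ℕ → ℕ} (h : HilbData xs M e τ) (n : ℕ) :
    hilb (Ideal.ofList xs) M n =
      e * Nat.multichoose (xs.length + 1) n + ∑ j ∈ Finset.range (n + 1), τ j := by
  rw [multichoose_succ_eq_sum]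
  exact h.pow_eq (n + 1)

theorem HilbData.eq_of_hilb_eq {xs : List R} {e : ℕ} {τ : ℕ → ℕ} (h : HilbData xs M e τ)
    {e' : ℕ} {f : ℕ → ℕ}
    (hf : ∀ n, hilb (Ideal.ofList xs) M n = e' * Nat.multichoose (xs.length + 1) n + f n)
    (hg : Growth 1 xs.length f) :
    e = e' ∧ ∀ n, ∑ j ∈ Finset.range (n + 1), τ j = f n := by
  have hee : e = e' := by
    apply le_antisymm
    · refine le_of_multichoose_le hg fun n => ?_
      rw [← hf, h.hilb_eq]
      exact Nat.le_add_right _ _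
    · refine le_of_multichoose_le h.growth fun n => ?_
      rw [← h.hilb_eq, hf]
      exact Nat.le_add_right _ _
  refine ⟨hee, fun n => ?_⟩
  have := hf n
  rw [h.hilb_eq, hee] at this
  exact Nat.add_left_cancel this

theorem HilbData.star_iff {xs : List R} {e : ℕ} {τ : ℕ → ℕ} (h : HilbData xs M e τ) :
    Star xs M ↔ Growth 2 xs.length (fun N => ∑ n ∈ Finset.range (N + 1), τ n) := by
  constructor
  · rintro ⟨e', f, hf, hg⟩
    exact hg.mono fun n => ((h.eq_of_hilb_eq hf hg.of_succ).2 n).le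
  · exact fun hg => ⟨e, _, h.hilb_eq, hg⟩

theorem sup_pow_le_sup (I J : Ideal R) (n : ℕ) : (I ⊔ J) ^ n ≤ I ⊔ J ^ n := by
  induction n with
  | zero => rw [pow_zero, pow_zero]; exact le_sup_right
  | succ n ih =>
    rw [pow_succ, Ideal.mul_le]
    intro x hx y hy
    obtain ⟨i, hi, j, hj, rfl⟩ := Submodule.mem_sup.1 (ih hx)
    obtain ⟨i', hi', j', hj', rfl⟩ := Submodule.mem_sup.1 hy
    refine Submodule.mem_sup.2 ⟨i * (i' + j') + j * i', ?_, j * j', ?_, by ring⟩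
    · exact I.add_mem (I.mul_mem_right _ hi) (I.mul_mem_left _ hi')
    · rw [pow_succ]
      exact Ideal.mul_mem_mul hj hj'

theorem comap_mkQ_smul_top (I : Ideal R) (A : Submodule R M) :
    (I • (⊤ : Submodule R (M ⧸ A))).comap A.mkQ = A ⊔ I • ⊤ := by
  have : I • (⊤ : Submodule R (M ⧸ A)) = (I • (⊤ : Submodule R M)).map A.mkQ := by
    rw [Submodule.map_smul'', Submodule.map_top, Submodule.range_mkQ]
  rw [this, Submodule.comap_map_mkQ]

theorem cl_quotient (I : Ideal R) (A : Submodule R M) :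
    cl (I • (⊤ : Submodule R (M ⧸ A))) = cl (A ⊔ I • (⊤ : Submodule R M)) := by
  rw [← comap_mkQ_smul_top, cl_comap_of_surjective A.mkQ_surjective]

theorem finCol_quotient {I : Ideal R} (A : Submodule R M) (h : FinCol (I • (⊤ : Submodule R M))) :
    FinCol (I • (⊤ : Submodule R (M ⧸ A))) := by
  refine finCol_of_comap_surjective A.mkQ_surjective ?_
  rw [comap_mkQ_smul_top]
  exact h.mono le_sup_right

theorem sup_ofList_pow_smul (a : R) (xs : List R) (n : ℕ) {A : Submodule R M}
    (hA : a • (⊤ : Submodule R M) ≤ A) :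
    A ⊔ Ideal.ofList xs ^ n • (⊤ : Submodule R M) =
      A ⊔ Ideal.ofList (a :: xs) ^ n • (⊤ : Submodule R M) := by
  rw [Ideal.ofList_cons]
  apply le_antisymm
  · exact sup_le_sup_left (Submodule.smul_mono (Ideal.pow_right_mono le_sup_right n) le_rfl) _
  · refine sup_le le_sup_left ((Submodule.smul_mono (sup_pow_le_sup _ _ n) le_rfl).trans ?_)
    rw [Submodule.sup_smul, Submodule.ideal_span_singleton_smul]
    exact sup_le_sup_right hA _

theorem finCol_quotient_of_cons {a : R} {xs : List R} {A : Submodule R M}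
    (hA : a • (⊤ : Submodule R M) ≤ A)
    (h : FinCol (Ideal.ofList (a :: xs) • (⊤ : Submodule R M))) :
    FinCol (Ideal.ofList xs • (⊤ : Submodule R (M ⧸ A))) := by
  refine finCol_of_comap_surjective A.mkQ_surjective ?_
  have := sup_ofList_pow_smul a xs 1 hA
  rw [pow_one, pow_one] at this
  rw [comap_mkQ_smul_top, this]
  exact h.mono le_sup_right

theorem hilb_quotient_of_cons {a : R} {xs : List R} {A : Submodule R M}
    (hA : a • (⊤ : Submodule R M) ≤ A) (n : ℕ) :
    hilb (Ideal.ofList xs) (M ⧸ A) n = cl (A ⊔ Ideal.ofList (a :: xs) ^ (n + 1) • ⊤) := by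
  rw [hilb, cl_quotient, sup_ofList_pow_smul a xs _ hA]

theorem range_lsmul_eq (a : R) : LinearMap.range (LinearMap.lsmul R M a) = a • ⊤ := by
  ext y
  simp [Submodule.mem_smul_pointwise_iff_exists]

theorem mem_ofList_cons (a : R) (xs : List R) : a ∈ Ideal.ofList (a :: xs) :=
  Ideal.subset_span (by simp)

theorem pow_smul_le_colon {I : Ideal R} {a : R} (ha : a ∈ I) (n : ℕ) :
    I ^ n • (⊤ : Submodule R M) ≤
      (I ^ (n + 1) • (⊤ : Submodule R M)).comap (LinearMap.lsmul R M a) := by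
  intro y hy
  rw [Submodule.mem_comap, LinearMap.lsmul_apply, pow_succ', Submodule.mul_smul]
  exact Submodule.smul_mem_smul ha hy

variable [IsNoetherianRing R]

theorem HilbData.cl_le_colon {xs : List R} {e : ℕ} {τ : ℕ → ℕ} (h : HilbData xs M e τ)
    (hQ : FinCol (Ideal.ofList xs • (⊤ : Submodule R M)))
    {a : R} (ha : a ∈ xs) {n k : ℕ} {K : Submodule R M} (hK : FinCol K)
    (hKle : K ≤ (Ideal.ofList xs ^ (n + 1) • (⊤ : Submodule R M)).comap (LinearMap.lsmul R M a))
    (hKk : K ≤ Ideal.ofList xs ^ k • ⊤) {m : ℕ} (hkm : k ≤ m) (hmn : m ≤ n) :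
    cl (K ⊓ Ideal.ofList xs ^ m • ⊤) ≤ cl K + ∑ j ∈ Finset.Ico k m, τ j := by
  induction m, hkm using Nat.le_induction with
  | base => simp [inf_eq_left.2 hKk]
  | succ m hkm ih =>
    have ih := ih (by omega)
    rw [Finset.sum_Ico_succ_top hkm]
    set Q := Ideal.ofList xs
    have hV : FinCol (K ⊓ Q ^ m • ⊤) := hK.inf (hQ.pow_smul_top m)
    have hm := cl_modular hV (hQ.pow_smul_top (m + 1))
    have hle : Q ^ (m + 1) • (⊤ : Submodule R M) ≤ Q ^ m • ⊤ :=
      Submodule.smul_mono (Ideal.pow_le_pow_right (Nat.le_succ m)) le_rfl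
    rw [inf_assoc, inf_eq_right.2 hle] at hm
    have h2 : cl (Q ^ m • (⊤ : Submodule R M) ⊓
        (Q ^ (m + 2) • (⊤ : Submodule R M)).comap (LinearMap.lsmul R M a)) ≤
        cl (K ⊓ Q ^ m • ⊤ ⊔ Q ^ (m + 1) • ⊤) := by
      refine cl_mono (hV.mono le_sup_left) (sup_le ?_ ?_)
      · refine le_inf inf_le_right (inf_le_left.trans (hKle.trans (Submodule.comap_mono ?_)))
        exact Submodule.smul_mono (Ideal.pow_le_pow_right (by omega)) le_rfl
      · refine le_inf hle ?_
        exact pow_smul_le_colon (show a ∈ Q from Ideal.subset_span ha) (m + 1)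
    have h3 : cl (Q ^ (m + 1) • (⊤ : Submodule R M)) ≤ cl (Q ^ m • (⊤ : Submodule R M) ⊓
        (Q ^ (m + 2) • (⊤ : Submodule R M)).comap (LinearMap.lsmul R M a)) + τ m :=
      h.colon m a ha
    omega

/-- The Hilbert function of `M / aM` in terms of that of `M`, for a generator `a` regular on `M`. -/
theorem HilbData.quotient [Module.Finite R M] {a : R} {xs : List R} {e e' : ℕ} {τ τ' : ℕ → ℕ}
    (h : HilbData (a :: xs) M e τ)
    (hQ : FinCol (Ideal.ofList (a :: xs) • (⊤ : Submodule R M)))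
    (ha : IsSMulRegular M a)
    (h' : HilbData xs (M ⧸ (a • ⊤ : Submodule R M)) e' τ') :
    e = e' ∧ ∃ c, ∀ N, ∑ n ∈ Finset.range (N + 1), ∑ j ∈ Finset.range (n + 1), τ' j ≤
      c * ∑ j ∈ Finset.range (N + 1), τ j := by
  set Q := Ideal.ofList (a :: xs) with hQdef
  have haQ : a ∈ Q := mem_ofList_cons a xs
  obtain ⟨c, hc⟩ := exists_comap_le Q (LinearMap.lsmul R M a) ha
  let K : ℕ → Submodule R M := fun n =>
    (Q ^ (n + 1) • (⊤ : Submodule R M)).comap (LinearMap.lsmul R M a)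
  have hKfin : ∀ n, FinCol (K n) := fun n => finCol_comap (hQ.pow_smul_top (n + 1))
  have hQK : ∀ n, Q ^ n • ⊤ ≤ K n := fun n => pow_smul_le_colon haQ n
  have hK : ∀ n, K n ≤ Q ^ (n - c) • ⊤ := fun n =>
    (hc (n + 1)).trans (Submodule.smul_mono (Ideal.pow_le_pow_right (by omega)) le_rfl)
  have hN : ∀ n, cl (K n) + hilb (Ideal.ofList xs) (M ⧸ (a • ⊤ : Submodule R M)) n =
      cl (Q ^ (n + 1) • (⊤ : Submodule R M)) := fun n => by
    rw [hilb_quotient_of_cons le_rfl, ← range_lsmul_eq]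
    exact cl_comap (LinearMap.lsmul R M a) (hQ.pow_smul_top (n + 1))
  let S : ℕ → ℕ := fun n => ∑ j ∈ Finset.range n, τ j
  have hSmono : Monotone S := fun i j hij =>
    Finset.sum_le_sum_of_subset (Finset.range_mono hij)
  have hl : ∀ n, cl (Q ^ n • (⊤ : Submodule R M)) + S (n - c) ≤ cl (K n) + S n := fun n => by
    have := h.cl_le_colon hQ (List.mem_cons_self) (hKfin n) le_rfl (hK n) (Nat.sub_le n c) le_rfl
    rw [inf_eq_right.2 (hQK n)] at this
    have h3 : S (n - c) + ∑ j ∈ Finset.Ico (n - c) n, τ j = S n :=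
      Finset.sum_range_add_sum_Ico _ (Nat.sub_le n c)
    omega
  have hKle : ∀ n, cl (K n) ≤ cl (Q ^ n • (⊤ : Submodule R M)) := fun n =>
    cl_mono (hQ.pow_smul_top n) (hQK n)
  set HN := hilb (Ideal.ofList xs) (M ⧸ (a • ⊤ : Submodule R M)) with hHN
  have hlow : ∀ N, cl (Q ^ N • (⊤ : Submodule R M)) ≤ ∑ n ∈ Finset.range N, HN n := fun N => by
    induction N with
    | zero => simp [cl_top]
    | succ N ih =>
      rw [Finset.sum_range_succ]
      have := hN N
      have := hKle N
      omega
  have hup : ∀ N, ∑ n ∈ Finset.range N, HN n + ∑ n ∈ Finset.range N, S (n - c) ≤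
      cl (Q ^ N • (⊤ : Submodule R M)) + ∑ n ∈ Finset.range N, S n := fun N => by
    induction N with
    | zero => simp
    | succ N ih =>
      rw [Finset.sum_range_succ, Finset.sum_range_succ, Finset.sum_range_succ]
      have := hN N
      have := hl N
      omega
  have hshift : ∀ N, ∑ n ∈ Finset.range (N + 1), S n ≤
      ∑ n ∈ Finset.range (N + 1), S (n - c) + c * S N := fun N => by
    refine (sum_range_le_shift hSmono c N).trans (Nat.add_le_add_right ?_ _)
    generalize N + 1 = L
    rcases le_total c L with hcL | hcL
    · obtain ⟨L', rfl⟩ := Nat.exists_eq_add_of_le hcL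
      rw [Nat.add_sub_cancel_left, Finset.sum_range_add]
      simp
    · simp [Nat.sub_eq_zero_of_le hcL]
  have hSN : ∀ N, S N ≤ S (N + 1) := fun N => hSmono (Nat.le_succ N)
  have hlen : (a :: xs).length = xs.length + 1 := rfl
  have hsum : ∀ N, ∑ n ∈ Finset.range (N + 1), HN n =
      e' * Nat.multichoose ((a :: xs).length + 1) N +
        ∑ n ∈ Finset.range (N + 1), ∑ j ∈ Finset.range (n + 1), τ' j := fun N => by
    rw [Finset.sum_congr rfl fun n _ => h'.hilb_eq n, Finset.sum_add_distrib,
      multichoose_succ_eq_sum, Finset.mul_sum, hlen]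
  have hM : ∀ N, cl (Q ^ (N + 1) • (⊤ : Submodule R M)) =
      e * Nat.multichoose ((a :: xs).length + 1) N + S (N + 1) := fun N => h.hilb_eq N
  have hupper : ∀ N, e' * Nat.multichoose ((a :: xs).length + 1) N +
        ∑ n ∈ Finset.range (N + 1), ∑ j ∈ Finset.range (n + 1), τ' j ≤
      e * Nat.multichoose ((a :: xs).length + 1) N + (c + 1) * S (N + 1) := fun N => by
    have h1 := hup (N + 1)
    have h2 := hshift N
    rw [hsum, hM] at h1
    have h3 := Nat.mul_le_mul_left c (hSN N)
    rw [add_mul, one_mul]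
    omega
  have hgr' : Growth 1 (a :: xs).length
      fun N => ∑ n ∈ Finset.range (N + 1), ∑ j ∈ Finset.range (n + 1), τ' j := by
    obtain ⟨C, hC⟩ := h'.growth
    refine ⟨C, fun N => ?_⟩
    have h1 : ∑ n ∈ Finset.range (N + 1), ∑ j ∈ Finset.range (n + 1), τ' j ≤
        (N + 1) * ∑ j ∈ Finset.range (N + 1), τ' j := by
      calc _ ≤ ∑ n ∈ Finset.range (N + 1), ∑ j ∈ Finset.range (N + 1), τ' j := by
            refine Finset.sum_le_sum fun n hn => Finset.sum_le_sum_of_subset ?_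
            exact Finset.range_mono (by have := Finset.mem_range.1 hn; omega)
        _ = _ := by simp
    have h2 := hC N
    rw [hlen, pow_succ (N + 1) xs.length, ← mul_assoc]
    calc _ ≤ (N + 1) * (∑ j ∈ Finset.range (N + 1), τ' j) * (N + 1) ^ 1 :=
          Nat.mul_le_mul_right _ h1
      _ = (∑ j ∈ Finset.range (N + 1), τ' j) * (N + 1) ^ 1 * (N + 1) := by ring
      _ ≤ _ := Nat.mul_le_mul_right _ h2
  have hee : e = e' := by
    apply le_antisymm
    · refine le_of_multichoose_le hgr' fun N => ?_
      have h1 := hlow (N + 1)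
      rw [hM, hsum] at h1
      omega
    · refine le_of_multichoose_le (h.growth.const_mul (c + 1)) fun N => ?_
      exact (Nat.le_add_right _ _).trans (hupper N)
  refine ⟨hee, c + 1, fun N => ?_⟩
  have := hupper N
  rw [hee] at this
  exact Nat.le_of_add_le_add_left this

theorem Star.quotient [IsLocalRing R] [Module.Finite R M] {a : R} {xs : List R}
    (h : Star (a :: xs) M) (hQ : FinCol (Ideal.ofList (a :: xs) • (⊤ : Submodule R M)))
    (ha : IsSMulRegular M a) : Star xs (M ⧸ (a • ⊤ : Submodule R M)) := by
  obtain ⟨e, τ, hd⟩ := exists_hilbData hQ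
  obtain ⟨e', τ', hd'⟩ := exists_hilbData
    (finCol_quotient_of_cons (A := (a • ⊤ : Submodule R M)) le_rfl hQ)
  obtain ⟨-, c, hc⟩ := hd.quotient hQ ha hd'
  rw [hd.star_iff] at h
  rw [hd'.star_iff]
  refine Growth.of_sum (fun i j hij => Finset.sum_le_sum_of_subset (Finset.range_mono ?_))
    ((h.const_mul c).mono hc)
  omega

end HilbertData

section Small

variable (R : Type*) [CommRing R] [IsLocalRing R]

/-- The `m`-adic Hilbert–Samuel function of `Z` has order of growth at most `s - 2`. -/
def Sm (s : ℕ) (Z : Type*) [AddCommGroup Z] [Module R Z] : Prop :=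
  Growth 2 s (hilb (maximalIdeal R) Z)

variable {R} [IsNoetherianRing R]
variable {Z Z' Z'' : Type*} [AddCommGroup Z] [Module R Z] [AddCommGroup Z'] [Module R Z']
  [AddCommGroup Z''] [Module R Z'']

omit [IsLocalRing R] [IsNoetherianRing R] in
theorem pow_smul_top_le_comap (I : Ideal R) (n : ℕ) (f : Z →ₗ[R] Z') :
    I ^ n • (⊤ : Submodule R Z) ≤ (I ^ n • (⊤ : Submodule R Z')).comap f := by
  rw [← Submodule.map_le_iff_le_comap, Submodule.map_smul'']
  exact Submodule.smul_mono le_rfl le_top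

theorem hilb_monotone {I : Ideal R} [Module.Finite R Z] (h : FinCol (I • (⊤ : Submodule R Z))) :
    Monotone (hilb I Z) := fun _ _ hij =>
  cl_mono (h.pow_smul_top _)
    (Submodule.smul_mono (Ideal.pow_le_pow_right (Nat.succ_le_succ hij)) le_rfl)

theorem hilb_maximalIdeal_monotone [Module.Finite R Z] : Monotone (hilb (maximalIdeal R) Z) :=
  hilb_monotone finCol_maximalIdeal_smul

theorem Sm.of_filtration {s : ℕ} {F : ℕ → Submodule R Z} (hF : ∀ n, FinCol (F n)) (c : ℕ)
    (h : ∀ n, F (n + c) ≤ maximalIdeal R ^ (n + 1) • ⊤) (hg : Growth 2 s fun n => cl (F n)) :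
    Sm R s Z :=
  hg.shift c fun n => cl_mono (hF (n + c)) (h n)

theorem Sm.of_surjective [Module.Finite R Z] {s : ℕ} (h : Sm R s Z) (f : Z →ₗ[R] Z')
    (hf : Function.Surjective f) : Sm R s Z' := by
  refine Growth.mono h fun n => ?_
  rw [hilb, hilb, ← cl_comap_of_surjective hf]
  exact cl_mono (finCol_pow_maximalIdeal_smul (n + 1)) (pow_smul_top_le_comap _ _ _)

theorem Sm.of_injective [Module.Finite R Z] {s : ℕ} (h : Sm R s Z) (f : Z' →ₗ[R] Z)
    (hf : Function.Injective f) : Sm R s Z' := by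
  obtain ⟨c, hc⟩ := exists_comap_le (maximalIdeal R) f hf
  have hfin : ∀ n, FinCol (maximalIdeal R ^ (n + 1) • (⊤ : Submodule R Z)) := fun n =>
    finCol_pow_maximalIdeal_smul (n + 1)
  refine Sm.of_filtration (F := fun n => (maximalIdeal R ^ (n + 1) • (⊤ : Submodule R Z)).comap f)
    (fun n => finCol_comap (hfin n)) c (fun n => ?_) (Growth.mono h fun n => ?_)
  · refine (hc _).trans (Submodule.smul_mono (Ideal.pow_le_pow_right (by omega)) le_rfl)
  · have := cl_comap f (hfin n)
    exact Nat.le.intro this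

theorem Sm.of_ker_le [Module.Finite R Z] [Module.Finite R Z''] {s : ℕ} (h : Sm R s Z'')
    (φ : Z →ₗ[R] Z') (hφ : Function.Surjective φ) (ψ : Z →ₗ[R] Z'')
    (hk : LinearMap.ker ψ ≤ LinearMap.ker φ) : Sm R s Z' := by
  have h1 : Sm R s (Z ⧸ LinearMap.ker ψ) :=
    h.of_injective ((LinearMap.ker ψ).liftQ ψ le_rfl)
      (LinearMap.ker_eq_bot.1 (Submodule.ker_liftQ_eq_bot' _ _ rfl))
  refine h1.of_surjective ((LinearMap.ker ψ).liftQ φ hk) fun y => ?_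
  obtain ⟨x, rfl⟩ := hφ y
  exact ⟨Submodule.Quotient.mk x, rfl⟩

theorem Sm.extension [Module.Finite R Z] {s : ℕ} {A : Submodule R Z} (h1 : Sm R s A)
    (h2 : Sm R s (Z ⧸ A)) : Sm R s Z := by
  refine (Growth.add h1 h2).mono fun n => ?_
  have h3 := cl_comap A.subtype
    (finCol_pow_maximalIdeal_smul (R := R) (M := Z) (n + 1))
  have h4 : cl ((maximalIdeal R ^ (n + 1) • (⊤ : Submodule R Z)).comap A.subtype) ≤
      hilb (maximalIdeal R) A n :=
    cl_mono (finCol_pow_maximalIdeal_smul (n + 1)) (pow_smul_top_le_comap _ _ _)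
  have h5 : hilb (maximalIdeal R) (Z ⧸ A) n = _ := cl_quotient (maximalIdeal R ^ (n + 1)) A
  rw [Submodule.range_subtype] at h3
  change cl _ ≤ _
  omega

theorem smul_top_le_maximalIdeal_smul {a : R} (ha : a ∈ maximalIdeal R) :
    a • (⊤ : Submodule R Z) ≤ maximalIdeal R • ⊤ := by
  rw [← Submodule.ideal_span_singleton_smul]
  exact Submodule.smul_mono ((Ideal.span_singleton_le_iff_mem _).2 ha) le_rfl

theorem subsingleton_of_maximalIdeal_smul [Module.Finite R Z]
    (h : (⊤ : Submodule R Z) ≤ maximalIdeal R • ⊤) : Subsingleton Z := by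
  rw [← Submodule.subsingleton_iff R, ← subsingleton_iff_bot_eq_top]
  exact (Submodule.eq_bot_of_le_smul_of_le_jacobson_bot _ _ Module.Finite.fg_top h
    (maximalIdeal_le_jacobson _)).symm

theorem subsingleton_of_smul_top [Module.Finite R Z] {a : R} (ha : a ∈ maximalIdeal R)
    (h : a • (⊤ : Submodule R Z) = ⊤) : Subsingleton Z :=
  subsingleton_of_maximalIdeal_smul (h.ge.trans (smul_top_le_maximalIdeal_smul ha))

theorem Sm.subsingleton [Module.Finite R Z] (h : Sm R 1 Z) : Subsingleton Z := by
  have h0 := Growth.eq_zero_of_monotone hilb_maximalIdeal_monotone h 0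
  rw [hilb, zero_add, pow_one] at h0
  refine subsingleton_of_maximalIdeal_smul (R := R) ?_
  exact (eq_of_cl_le (finCol_maximalIdeal_smul (R := R) (M := Z)) le_top
    (by rw [h0]; exact Nat.zero_le _)).ge

theorem Sm.succ {s : ℕ} (h : Sm R s Z) : Sm R (s + 1) Z := Growth.succ_right h

theorem Sm.of_subsingleton [Subsingleton Z] (s : ℕ) : Sm R s Z := by
  refine (Growth.zero 2 s).mono fun n => ?_
  rw [hilb, Subsingleton.elim (maximalIdeal R ^ (n + 1) • (⊤ : Submodule R Z)) ⊤, cl_top]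

/-- Killing a nonzerodivisor lowers the order of growth. -/
theorem Sm.quotSMulTop [Module.Finite R Z] {s : ℕ} (h : Sm R (s + 1) Z) {a : R}
    (hr : IsSMulRegular Z a) : Sm R s (QuotSMulTop a Z) := by
  set I := maximalIdeal R
  obtain ⟨c, hc⟩ := exists_comap_le I (LinearMap.lsmul R Z a) hr
  have hfin : ∀ n, FinCol (I ^ n • (⊤ : Submodule R Z)) := finCol_pow_maximalIdeal_smul
  have hmono : Monotone (hilb I Z) := hilb_maximalIdeal_monotone
  have h1 : ∀ n, hilb I (QuotSMulTop a Z) n + cl (I ^ (n + 1 - c) • (⊤ : Submodule R Z)) ≤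
      hilb I Z n := fun n => by
    have h2 := cl_comap (LinearMap.lsmul R Z a) (hfin (n + 1))
    have h3 := cl_mono (finCol_comap (hfin (n + 1))) (hc (n + 1))
    rw [range_lsmul_eq] at h2
    rw [hilb, cl_quotient, hilb]
    omega
  have h2 : ∀ N, ∑ n ∈ Finset.range (N + 1), hilb I (QuotSMulTop a Z) n ≤ c * hilb I Z N :=
    fun N => by
      have h3 := Finset.sum_le_sum fun n (_ : n ∈ Finset.range (N + 1)) => h1 n
      rw [Finset.sum_add_distrib] at h3
      have h4 := sum_range_le_shift hmono c N
      have h5 : ∑ n ∈ Finset.range (N + 1 - c), hilb I Z n ≤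
          ∑ n ∈ Finset.range (N + 1), cl (I ^ (n + 1 - c) • (⊤ : Submodule R Z)) := by
        rcases le_total c (N + 1) with hcN | hcN
        · obtain ⟨L, hL⟩ := Nat.exists_eq_add_of_le hcN
          rw [hL, Nat.add_sub_cancel_left, Finset.sum_range_add]
          refine le_add_left (Finset.sum_le_sum fun n _ => ?_)
          rw [show c + n + 1 - c = n + 1 by omega]
          rfl
        · simp [Nat.sub_eq_zero_of_le hcN]
      omega
  exact Growth.of_sum hilb_maximalIdeal_monotone ((Growth.const_mul h c).mono h2)

theorem Sm.of_quotSMulTop [Module.Finite R Z] {s : ℕ} {a : R} (h : Sm R s (QuotSMulTop a Z))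
    (ha : a ∈ maximalIdeal R) : Sm R (s + 1) Z := by
  set I := maximalIdeal R
  have hfin : ∀ n, FinCol (I ^ n • (⊤ : Submodule R Z)) := finCol_pow_maximalIdeal_smul
  have h1 : ∀ n, hilb I Z n ≤ cl (I ^ n • (⊤ : Submodule R Z)) +
      hilb I (QuotSMulTop a Z) n := fun n => by
    have h2 := cl_comap (LinearMap.lsmul R Z a) (hfin (n + 1))
    have h3 := cl_mono (hfin n) (pow_smul_le_colon (M := Z) ha n)
    rw [range_lsmul_eq] at h2
    rw [hilb, hilb, cl_quotient]
    omega
  have h2 : ∀ N, hilb I Z N ≤ ∑ n ∈ Finset.range (N + 1), hilb I (QuotSMulTop a Z) n := fun N => by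
    induction N with
    | zero =>
      have := h1 0
      rw [pow_zero, Ideal.one_eq_top, Submodule.top_smul, cl_top] at this
      simpa using this
    | succ N ih =>
      rw [Finset.sum_range_succ]
      exact (h1 (N + 1)).trans (Nat.add_le_add_right ih _)
  obtain ⟨C, hC⟩ := h
  refine ⟨C, fun N => ?_⟩
  have h3 : hilb I Z N ≤ (N + 1) * hilb I (QuotSMulTop a Z) N := by
    refine (h2 N).trans ?_
    refine (Finset.sum_le_card_nsmul _ _ (hilb I (QuotSMulTop a Z) N) fun n hn => ?_).trans ?_
    · exact hilb_maximalIdeal_monotone (by have := Finset.mem_range.1 hn; omega)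
    · simp
  calc hilb I Z N * (N + 1) ^ 2 ≤ (N + 1) * hilb I (QuotSMulTop a Z) N * (N + 1) ^ 2 :=
        Nat.mul_le_mul_right _ h3
    _ = hilb I (QuotSMulTop a Z) N * (N + 1) ^ 2 * (N + 1) := by ring
    _ ≤ C * (N + 1) ^ s * (N + 1) := Nat.mul_le_mul_right _ (hC N)
    _ = C * (N + 1) ^ (s + 1) := by ring

end Small

theorem exists_le_maximal_of_wellFoundedGT {α : Type*} [PartialOrder α] [WellFoundedGT α]
    (P : α → Prop) (a : α) (ha : P a) : ∃ b, a ≤ b ∧ Maximal P b := by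
  obtain ⟨b, ⟨hab, hb⟩, hmax⟩ := wellFounded_gt.has_min {b | a ≤ b ∧ P b} ⟨a, le_rfl, ha⟩
  refine ⟨b, hab, hb, fun c hc hbc => ?_⟩
  by_contra hcb
  exact hmax c ⟨hab.trans hbc, hc⟩ (lt_of_le_not_ge hbc hcb)

section WeaklyRegular

open RingTheory.Sequence

universe u v

variable {R : Type u} [CommRing R] [IsLocalRing R] [IsNoetherianRing R]

/-- A submodule of small growth of a module with a long weakly regular sequence vanishes. -/
theorem eq_bot_of_isWeaklyRegular {ys : List R} (hys : ∀ y ∈ ys, y ∈ maximalIdeal R) :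
    ∀ {C : Type v} [AddCommGroup C] [Module R C] [Module.Finite R C],
      IsWeaklyRegular C ys → ∀ Z : Submodule R C, Sm R (ys.length + 1) Z → Z = ⊥ := by
  induction ys with
  | nil =>
    intro C _ _ _ _ Z hZ
    exact (Submodule.subsingleton_iff_eq_bot).1 hZ.subsingleton
  | cons y ys ih =>
    intro C _ _ _ hC Z hZ
    rw [isWeaklyRegular_cons_iff] at hC
    obtain ⟨Y, hZY, hY⟩ := exists_le_maximal_of_wellFoundedGT
      (fun Y : Submodule R C => Sm R ((y :: ys).length + 1) Y) Z hZ
    suffices h : Y = ⊥ from le_bot_iff.1 (h ▸ hZY)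
    have hcomap : ∀ x, y • x ∈ Y → x ∈ Y := by
      have hle : Y ≤ Y.comap (LinearMap.lsmul R C y) := fun x hx => Y.smul_mem y hx
      have hsm : Sm R ((y :: ys).length + 1) (Y.comap (LinearMap.lsmul R C y)) := by
        refine hY.1.of_injective
          ((LinearMap.lsmul R C y).restrict (p := Y.comap (LinearMap.lsmul R C y)) (q := Y)
            fun x hx => hx) fun x x' hxx => ?_
        exact Subtype.ext (hC.1 (congrArg Subtype.val hxx))
      exact fun x hx => hY.2 hsm hle hx
    have hreg : IsSMulRegular Y y := fun x x' hxx =>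
      Subtype.ext (hC.1 (congrArg Subtype.val hxx))
    have h0 : Y.map (y • (⊤ : Submodule R C)).mkQ = ⊥ := by
      refine ih (fun z hz => hys z (List.mem_cons_of_mem _ hz)) hC.2 _ ?_
      have h1 : Sm R (ys.length + 1) (QuotSMulTop y Y) := hY.1.quotSMulTop hreg
      refine h1.of_ker_le
        ((y • (⊤ : Submodule R C)).mkQ.restrict (p := Y)
          (q := Y.map (y • (⊤ : Submodule R C)).mkQ) fun x hx => ⟨x, hx, rfl⟩) ?_
        (y • (⊤ : Submodule R Y)).mkQ ?_
      · rintro ⟨_, x, hx, rfl⟩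
        exact ⟨⟨x, hx⟩, rfl⟩
      · rw [Submodule.ker_mkQ]
        intro x hx
        obtain ⟨z, -, rfl⟩ := (Submodule.mem_smul_pointwise_iff_exists _ _ _).1 hx
        refine LinearMap.mem_ker.2 (Subtype.ext ?_)
        exact (Submodule.Quotient.mk_eq_zero _).2
          ((Submodule.mem_smul_pointwise_iff_exists _ _ _).2 ⟨z, trivial, rfl⟩)
    rw [← Submodule.subsingleton_iff_eq_bot]
    refine subsingleton_of_smul_top (hys y List.mem_cons_self) (eq_top_iff.2 fun x _ => ?_)
    have hx : (x : C) ∈ y • (⊤ : Submodule R C) := by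
      rw [← Submodule.Quotient.mk_eq_zero, ← Submodule.mem_bot R, ← h0]
      exact ⟨x, x.2, rfl⟩
    obtain ⟨z, -, hz⟩ := (Submodule.mem_smul_pointwise_iff_exists _ _ _).1 hx
    refine (Submodule.mem_smul_pointwise_iff_exists _ _ _).2 ⟨⟨z, ?_⟩, trivial, Subtype.ext hz⟩
    exact hcomap z (hz ▸ x.2)

/-- An injection between modules with a weakly regular sequence whose cokernel has small growth
is surjective. -/
theorem surjective_of_isWeaklyRegular {ys : List R} (hys : ∀ y ∈ ys, y ∈ maximalIdeal R) :
    ∀ {A B : Type v} [AddCommGroup A] [Module R A] [Module.Finite R A]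
      [AddCommGroup B] [Module R B] [Module.Finite R B],
      IsWeaklyRegular A ys → IsWeaklyRegular B ys → ∀ f : A →ₗ[R] B, Function.Injective f →
        Sm R ys.length (B ⧸ LinearMap.range f) → Function.Surjective f := by
  induction ys with
  | nil =>
    intro A B _ _ _ _ _ _ _ _ f _ hf
    rw [← LinearMap.range_eq_top, ← Submodule.Quotient.subsingleton_iff]
    exact (Sm.succ hf).subsingleton
  | cons y ys ih =>
    intro A B _ _ _ _ _ _ hA hB f hinj hf
    have hA' := hA
    rw [isWeaklyRegular_cons_iff] at hA hB
    have hym := hys y List.mem_cons_self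
    have hys' : ∀ z ∈ ys, z ∈ maximalIdeal R := fun z hz => hys z (List.mem_cons_of_mem _ hz)
    let P : Submodule R B := (LinearMap.range f).comap (LinearMap.lsmul R B y)
    let φ : P →ₗ[R] QuotSMulTop y A :=
      (y • (⊤ : Submodule R A)).mkQ ∘ₗ (LinearEquiv.ofInjective f hinj).symm.toLinearMap ∘ₗ
        (LinearMap.lsmul R B y).restrict (p := P) (q := LinearMap.range f) fun x hx => hx
    have hφ : ∀ (b : P) (a : A), f a = y • (b : B) → φ b = Submodule.Quotient.mk a := by
      intro b a hab
      have : (LinearEquiv.ofInjective f hinj).symm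
          ((LinearMap.lsmul R B y).restrict (p := P) (q := LinearMap.range f)
            (fun x hx => hx) b) = a := by
        rw [LinearEquiv.symm_apply_eq]
        exact Subtype.ext hab.symm
      exact congrArg Submodule.Quotient.mk this
    have hker : LinearMap.range φ = ⊥ := by
      refine eq_bot_of_isWeaklyRegular hys' hA.2 _ ?_
      refine Sm.of_ker_le (s := ys.length + 1) hf φ.rangeRestrict φ.surjective_rangeRestrict
        ((LinearMap.range f).mkQ ∘ₗ P.subtype) fun b hb => ?_
      have hb' : (b : B) ∈ LinearMap.range f := (Submodule.Quotient.mk_eq_zero _).1 hb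
      obtain ⟨a, ha⟩ := hb'
      rw [LinearMap.ker_rangeRestrict, LinearMap.mem_ker, hφ b (y • a) (by rw [map_smul, ha])]
      exact (Submodule.Quotient.mk_eq_zero _).2
        ((Submodule.mem_smul_pointwise_iff_exists _ _ _).2 ⟨a, trivial, rfl⟩)
    have hlift : ∀ (b : B) (a : A), f a = y • b → ∃ a', f a' = b := by
      intro b a hab
      have h1 : φ ⟨b, ⟨a, hab⟩⟩ = 0 := by
        rw [← Submodule.mem_bot R, ← hker]
        exact LinearMap.mem_range_self _ _
      rw [hφ _ a hab, Submodule.Quotient.mk_eq_zero] at h1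
      obtain ⟨a', -, rfl⟩ := (Submodule.mem_smul_pointwise_iff_exists _ _ _).1 h1
      refine ⟨a', hB.1 ?_⟩
      change y • f a' = y • b
      rw [← hab, map_smul]
    have hreg : IsSMulRegular (B ⧸ LinearMap.range f) y := by
      rw [isSMulRegular_quotient_iff_mem_of_smul_mem]
      rintro b ⟨a, ha⟩
      exact hlift b a ha
    have hsurj : Function.Surjective (QuotSMulTop.map y f) := by
      refine ih hys' hA.2 hB.2 _ ?_ ?_
      · rw [injective_iff_map_eq_zero]
        intro a ha
        obtain ⟨a, rfl⟩ := Submodule.Quotient.mk_surjective _ a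
        rw [QuotSMulTop.map_apply_mk, Submodule.Quotient.mk_eq_zero] at ha
        obtain ⟨b, -, hb⟩ := (Submodule.mem_smul_pointwise_iff_exists _ _ _).1 ha
        obtain ⟨a', rfl⟩ := hlift b a hb.symm
        rw [Submodule.Quotient.mk_eq_zero]
        refine (Submodule.mem_smul_pointwise_iff_exists _ _ _).2 ⟨a', trivial, hinj ?_⟩
        rw [map_smul, hb]
      · have h1 : Sm R ys.length (QuotSMulTop y (B ⧸ LinearMap.range f)) :=
          Sm.quotSMulTop hf hreg
        refine h1.of_ker_le
          ((LinearMap.range (QuotSMulTop.map y f)).mkQ ∘ₗ (y • (⊤ : Submodule R B)).mkQ)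
          ((Submodule.mkQ_surjective _).comp (Submodule.mkQ_surjective _))
          ((y • (⊤ : Submodule R (B ⧸ LinearMap.range f))).mkQ ∘ₗ (LinearMap.range f).mkQ) ?_
        intro b hb
        have hb' : (Submodule.Quotient.mk b : B ⧸ LinearMap.range f) ∈
            y • (⊤ : Submodule R (B ⧸ LinearMap.range f)) :=
          (Submodule.Quotient.mk_eq_zero _).1 hb
        obtain ⟨c, -, hc⟩ := (Submodule.mem_smul_pointwise_iff_exists _ _ _).1 hb'
        obtain ⟨c, rfl⟩ := Submodule.Quotient.mk_surjective _ c
        rw [← Submodule.Quotient.mk_smul, Submodule.Quotient.eq] at hc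
        obtain ⟨a, ha⟩ := hc
        refine (Submodule.Quotient.mk_eq_zero _).2 ⟨- Submodule.Quotient.mk a, ?_⟩
        rw [map_neg, QuotSMulTop.map_apply_mk, ha, ← Submodule.Quotient.mk_neg, neg_sub,
          Submodule.mkQ_apply, Submodule.Quotient.eq, sub_sub_cancel_left, neg_mem_iff]
        exact (Submodule.mem_smul_pointwise_iff_exists _ _ _).2 ⟨c, trivial, rfl⟩
    rw [← LinearMap.range_eq_top, ← Submodule.Quotient.subsingleton_iff]
    refine subsingleton_of_smul_top hym (eq_top_iff.2 fun b _ => ?_)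
    obtain ⟨b, rfl⟩ := Submodule.Quotient.mk_surjective _ b
    obtain ⟨a, ha⟩ := hsurj (Submodule.Quotient.mk b)
    obtain ⟨a, rfl⟩ := Submodule.Quotient.mk_surjective _ a
    rw [QuotSMulTop.map_apply_mk, Submodule.Quotient.eq] at ha
    obtain ⟨c, -, hc⟩ := (Submodule.mem_smul_pointwise_iff_exists _ _ _).1 ha
    refine (Submodule.mem_smul_pointwise_iff_exists _ _ _).2
      ⟨- Submodule.Quotient.mk c, trivial, ?_⟩
    rw [smul_neg, ← Submodule.Quotient.mk_smul, hc, ← Submodule.Quotient.mk_neg, neg_sub,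
      Submodule.Quotient.eq, sub_sub_cancel_left, neg_mem_iff]
    exact LinearMap.mem_range_self _ _

omit [IsLocalRing R] [IsNoetherianRing R] in
/-- The kernel of a surjection between modules with a weakly regular sequence inherits it. -/
theorem isWeaklyRegular_kernel {ys : List R} :
    ∀ {K B C : Type v} [AddCommGroup K] [Module R K] [AddCommGroup B] [Module R B]
      [AddCommGroup C] [Module R C],
      IsWeaklyRegular B ys → IsWeaklyRegular C ys → ∀ (f : K →ₗ[R] B) (g : B →ₗ[R] C),
        Function.Injective f → Function.Exact f g → Function.Surjective g →
          IsWeaklyRegular K ys := by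
  induction ys with
  | nil => intros; exact IsWeaklyRegular.nil _ _
  | cons y ys ih =>
    intro K B C _ _ _ _ _ _ hB hC f g hf hfg hg
    rw [isWeaklyRegular_cons_iff] at hB hC ⊢
    refine ⟨hB.1.of_injective f hf, ?_⟩
    refine ih hB.2 hC.2 (QuotSMulTop.map y f) (QuotSMulTop.map y g) ?_
      (QuotSMulTop.map_exact y hfg hg) (QuotSMulTop.map_surjective y hg)
    rw [injective_iff_map_eq_zero]
    intro a ha
    obtain ⟨a, rfl⟩ := Submodule.Quotient.mk_surjective _ a
    rw [QuotSMulTop.map_apply_mk, Submodule.Quotient.mk_eq_zero] at ha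
    obtain ⟨b, -, hb⟩ := (Submodule.mem_smul_pointwise_iff_exists _ _ _).1 ha
    have hgb : g b = 0 := by
      apply hC.1
      change y • g b = y • (0 : C)
      rw [← map_smul, hb, smul_zero]
      exact hfg.apply_apply_eq_zero a
    obtain ⟨a', rfl⟩ := (hfg b).1 hgb
    rw [Submodule.Quotient.mk_eq_zero]
    refine (Submodule.mem_smul_pointwise_iff_exists _ _ _).2 ⟨a', trivial, hf ?_⟩
    rw [map_smul, hb]

end WeaklyRegular

section Star

variable {R : Type*} [CommRing R] {M : Type*} [AddCommGroup M] [Module R M]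
  {A B C : Type*} [AddCommGroup A] [Module R A] [AddCommGroup B] [Module R B]
  [AddCommGroup C] [Module R C]

theorem hilb_congr (I : Ideal R) (e : A ≃ₗ[R] B) : hilb I A = hilb I B := by
  funext n
  rw [hilb, hilb, ← cl_comap_of_surjective (f := e.toLinearMap) e.surjective]
  congr 1
  refine le_antisymm (pow_smul_top_le_comap I (n + 1) e.toLinearMap) fun x hx => ?_
  have := pow_smul_top_le_comap I (n + 1) e.symm.toLinearMap hx
  simpa using this

theorem Star.congr {xs : List R} (h : Star xs A) (e : A ≃ₗ[R] B) : Star xs B := by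
  rw [Star, ← hilb_congr _ e]
  exact h

theorem Star.nil : Star ([] : List R) M := by
  refine ⟨cl (⊥ : Submodule R M), fun _ => 0, fun n => ?_, Growth.zero _ _⟩
  rw [hilb, Ideal.ofList_nil, Ideal.bot_pow (Nat.succ_ne_zero n)]
  simp

theorem Star.of_subsingleton [Subsingleton M] (xs : List R) : Star xs M := by
  refine ⟨0, fun _ => 0, fun n => ?_, Growth.zero _ _⟩
  rw [hilb, Subsingleton.elim (Ideal.ofList xs ^ (n + 1) • (⊤ : Submodule R M)) ⊤, cl_top]
  simp

/-- Two modules are isomorphic when they are quotients of a third one by the same kernel. -/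
noncomputable def equivOfKerEq {f : M →ₗ[R] A} {g : M →ₗ[R] B} (hf : Function.Surjective f)
    (hg : Function.Surjective g) (h : LinearMap.ker f = LinearMap.ker g) : A ≃ₗ[R] B :=
  (f.quotKerEquivOfSurjective hf).symm ≪≫ₗ Submodule.quotEquivOfEq _ _ h ≪≫ₗ
    g.quotKerEquivOfSurjective hg

/-- The third isomorphism theorem for the pullback of a submodule of a quotient. -/
noncomputable def quotientComapEquiv (K : Submodule R M) (L : Submodule R (M ⧸ K)) :
    ((M ⧸ K) ⧸ L) ≃ₗ[R] M ⧸ L.comap K.mkQ :=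
  equivOfKerEq (f := L.mkQ ∘ₗ K.mkQ) (g := (L.comap K.mkQ).mkQ)
    ((Submodule.mkQ_surjective _).comp (Submodule.mkQ_surjective _))
    (Submodule.mkQ_surjective _) (by rw [LinearMap.ker_comp, Submodule.ker_mkQ, Submodule.ker_mkQ])

variable [IsLocalRing R] [IsNoetherianRing R]

theorem Star.of_hilb_le {xs : List R} (hQ : FinCol (Ideal.ofList xs • (⊤ : Submodule R M)))
    {e : ℕ} {f g : ℕ → ℕ}
    (hf : ∀ n, hilb (Ideal.ofList xs) M n ≤ e * Nat.multichoose (xs.length + 1) n + f n)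
    (hg : ∀ n, e * Nat.multichoose (xs.length + 1) n ≤ hilb (Ideal.ofList xs) M n + g n)
    (hf' : Growth 2 xs.length f) (hg' : Growth 1 xs.length g) : Star xs M := by
  obtain ⟨e', τ, h⟩ := exists_hilbData hQ
  have hee : e' = e := by
    apply le_antisymm
    · refine le_of_multichoose_le hf'.of_succ fun n => ?_
      have := hf n
      rw [h.hilb_eq] at this
      omega
    · refine le_of_multichoose_le (hg'.add h.growth) fun n => ?_
      have := hg n
      rw [h.hilb_eq] at this
      omega
  rw [h.star_iff]
  refine hf'.mono fun n => ?_
  have := hf n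
  rw [h.hilb_eq, hee] at this
  omega

theorem Star.of_exact [Module.Finite R A] [Module.Finite R B] [Module.Finite R C] {xs : List R}
    (hQ : FinCol (Ideal.ofList xs • (⊤ : Submodule R B)))
    (hQA : FinCol (Ideal.ofList xs • (⊤ : Submodule R A)))
    (hA : Star xs A) (hC : Star xs C) (f : A →ₗ[R] B) (g : B →ₗ[R] C)
    (hf : Function.Injective f) (hfg : Function.Exact f g) (hg : Function.Surjective g) :
    Star xs B := by
  rcases Nat.eq_zero_or_pos xs.length with h0 | h0
  · rw [List.length_eq_zero_iff.1 h0]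
    exact Star.nil
  set Q := Ideal.ofList xs
  obtain ⟨eA, τ, hdA⟩ := exists_hilbData hQA
  obtain ⟨eC, fC, hC, hCg⟩ := hC
  rw [hdA.star_iff] at hA
  obtain ⟨c, hc⟩ := exists_comap_le Q f hf
  have hB : ∀ n, cl ((Q ^ (n + 1) • (⊤ : Submodule R B)).comap f) + hilb Q C n = hilb Q B n :=
    fun n => by
      have h1 := cl_comap f (hQ.pow_smul_top (n + 1))
      have h2 : LinearMap.range f ⊔ Q ^ (n + 1) • ⊤ =
          (Q ^ (n + 1) • (⊤ : Submodule R C)).comap g := by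
        have : Q ^ (n + 1) • (⊤ : Submodule R C) = (Q ^ (n + 1) • (⊤ : Submodule R B)).map g := by
          rw [Submodule.map_smul'', Submodule.map_top, LinearMap.range_eq_top.2 hg]
        rw [this, Submodule.comap_map_eq, hfg.linearMap_ker_eq, sup_comm]
      rw [h2, cl_comap_of_surjective hg] at h1
      exact h1
  refine Star.of_hilb_le hQ (e := eA + eC)
    (f := fun n => ∑ j ∈ Finset.range (n + 1), τ j + fC n)
    (g := fun n => eA * (c * Nat.multichoose xs.length n)) (fun n => ?_) (fun n => ?_)
    (hA.add hCg) (((growth_multichoose _).const_mul c).const_mul eA)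
  · change hilb Q B n ≤ _
    have h1 := hB n
    have h2 := cl_mono (hQA.pow_smul_top (n + 1)) (pow_smul_top_le_comap Q (n + 1) f)
    have h3 : cl (Q ^ (n + 1) • (⊤ : Submodule R A)) = _ := hdA.hilb_eq n
    rw [hC] at h1
    rw [add_mul]
    omega
  · change _ ≤ hilb Q B n + _
    have h1 := hB n
    have h2 := cl_mono (finCol_comap (f := f) (hQ.pow_smul_top (n + 1))) (hc (n + 1))
    have h3 : cl (Q ^ (n + 1 - c) • (⊤ : Submodule R A)) = _ := hdA.pow_eq (n + 1 - c)
    have h4 := Nat.mul_le_mul_left eA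
      (sum_range_le_shift (multichoose_mono (d := xs.length) (by omega)) c n)
    rw [← multichoose_succ_eq_sum, mul_add] at h4
    rw [hC] at h1
    rw [add_mul]
    omega

theorem Star.torsion [Module.Finite R M] {xs : List R} (h : Star xs M)
    (hQ : FinCol (Ideal.ofList xs • (⊤ : Submodule R M))) (hxs : ∀ x ∈ xs, x ∈ maximalIdeal R)
    {a : R} (ha : a ∈ xs) :
    Sm R xs.length (LinearMap.ker (LinearMap.lsmul R M a)) ∧
      Star xs (M ⧸ LinearMap.ker (LinearMap.lsmul R M a)) := by
  set L := LinearMap.ker (LinearMap.lsmul R M a)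
  set Q := Ideal.ofList xs with hQd
  have haQ : a ∈ Q := Ideal.subset_span ha
  have hQm : Q ≤ maximalIdeal R := Ideal.span_le.2 hxs
  obtain ⟨e, τ, hd⟩ := exists_hilbData hQ
  have hsum := hd.star_iff.1 h
  have hL : ∀ n, cl ((Q ^ (n + 1) • (⊤ : Submodule R M)).comap L.subtype) +
      cl (L ⊔ Q ^ (n + 1) • (⊤ : Submodule R M)) = cl (Q ^ (n + 1) • (⊤ : Submodule R M)) :=
    fun n => by
      have h1 := cl_comap L.subtype (hQ.pow_smul_top (n + 1))
      rwa [Submodule.range_subtype] at h1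
  have hle : ∀ n, cl ((Q ^ (n + 1) • (⊤ : Submodule R M)).comap L.subtype) ≤
      ∑ j ∈ Finset.range (n + 1), τ j := fun n => by
    have h1 : cl ((L ⊔ Q ^ (n + 1) • (⊤ : Submodule R M)) ⊓ Q ^ (n + 1) • ⊤) ≤
        cl (L ⊔ Q ^ (n + 1) • (⊤ : Submodule R M)) + ∑ j ∈ Finset.Ico 0 (n + 1), τ j := by
      refine hd.cl_le_colon hQ ha (n := n + 1) ((hQ.pow_smul_top (n + 1)).mono le_sup_right)
        (sup_le ?_ (pow_smul_le_colon haQ (n + 1))) ?_ (Nat.zero_le _) le_rfl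
      · intro x hx
        rw [Submodule.mem_comap, LinearMap.mem_ker.1 hx]
        exact Submodule.zero_mem _
      · rw [pow_zero, Ideal.one_eq_top, Submodule.top_smul]
        exact le_top
    rw [inf_eq_right.2 le_sup_right, ← Finset.range_eq_Ico] at h1
    have := hL n
    omega
  refine ⟨?_, ?_⟩
  · obtain ⟨c, hc⟩ := exists_comap_le (maximalIdeal R) L.subtype L.injective_subtype
    refine Sm.of_filtration
      (F := fun n => (Q ^ (n + 1) • (⊤ : Submodule R M)).comap L.subtype)
      (fun n => finCol_comap (hQ.pow_smul_top (n + 1))) c (fun n => ?_) (hsum.mono hle)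
    refine (Submodule.comap_mono (Submodule.smul_mono (Ideal.pow_right_mono hQm _)
      le_rfl)).trans ((hc _).trans ?_)
    exact Submodule.smul_mono (Ideal.pow_le_pow_right (by omega)) le_rfl
  · have hH : ∀ n, hilb Q (M ⧸ L) n = cl (L ⊔ Q ^ (n + 1) • (⊤ : Submodule R M)) :=
      fun n => cl_quotient _ _
    refine Star.of_hilb_le (finCol_quotient L hQ) (e := e)
      (f := fun n => ∑ j ∈ Finset.range (n + 1), τ j)
      (g := fun n => ∑ j ∈ Finset.range (n + 1), τ j) (fun n => ?_) (fun n => ?_) hsum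
      hsum.of_succ
    · have h1 := hL n
      have h2 : cl (Q ^ (n + 1) • (⊤ : Submodule R M)) = _ := hd.hilb_eq n
      rw [hH]
      omega
    · have h1 := hL n
      have h2 : cl (Q ^ (n + 1) • (⊤ : Submodule R M)) = _ := hd.hilb_eq n
      have h3 := hle n
      rw [hH]
      omega

theorem Sm.comap_mkQ [Module.Finite R M] {s : ℕ} {K : Submodule R M} {W : Submodule R (M ⧸ K)}
    (hK : Sm R s K) (hW : Sm R s W) : Sm R s (W.comap K.mkQ) := by
  let φ : W.comap K.mkQ →ₗ[R] W := K.mkQ.restrict fun x hx => hx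
  have h1 : ∀ x : W.comap K.mkQ, x ∈ LinearMap.ker φ → (x : M) ∈ K := fun x hx =>
    (Submodule.Quotient.mk_eq_zero _).1 (congrArg Subtype.val hx)
  refine Sm.extension (A := LinearMap.ker φ) ?_ ?_
  · refine hK.of_injective (((W.comap K.mkQ).subtype.restrict (p := LinearMap.ker φ) (q := K))
      fun x hx => h1 x hx) fun x y hxy => ?_
    exact Subtype.ext (Subtype.ext (congrArg K.subtype hxy))
  · exact hW.of_ker_le _ (Submodule.mkQ_surjective _) φ (by rw [Submodule.ker_mkQ])

end Star

section LinCompact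

/-- A countable form of linear compactness. -/
def LinCompact (R : Type*) [CommRing R] (M : Type*) [AddCommGroup M] [Module R M] : Prop :=
  ∀ V : ℕ → Submodule R M, Antitone V → ∀ B : Submodule R M, ⨅ n, (V n ⊔ B) ≤ (⨅ n, V n) ⊔ B

theorem LinCompact.quotient {R : Type*} [CommRing R] {M : Type*} [AddCommGroup M] [Module R M]
    (h : LinCompact R M) (K : Submodule R M) : LinCompact R (M ⧸ K) := by
  intro V hV B x hx
  obtain ⟨x, rfl⟩ := Submodule.Quotient.mk_surjective _ x
  have h1 : x ∈ ⨅ n, ((V n).comap K.mkQ ⊔ B.comap K.mkQ) := by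
    rw [Submodule.mem_iInf] at hx ⊢
    intro n
    obtain ⟨v, hv, b, hb, hvb⟩ := Submodule.mem_sup.1 (hx n)
    obtain ⟨v, rfl⟩ := Submodule.Quotient.mk_surjective _ v
    refine Submodule.mem_sup.2 ⟨v, hv, x - v, ?_, by abel⟩
    change Submodule.Quotient.mk (x - v) ∈ B
    rw [Submodule.Quotient.mk_sub, ← hvb, add_sub_cancel_left]
    exact hb
  obtain ⟨v, hv, b, hb, rfl⟩ := Submodule.mem_sup.1
    (h _ (fun i j hij => Submodule.comap_mono (hV hij)) _ h1)
  refine Submodule.mem_sup.2 ⟨Submodule.Quotient.mk v, ?_, Submodule.Quotient.mk b, hb, rfl⟩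
  rw [Submodule.mem_iInf] at hv ⊢
  exact hv

end LinCompact

section Structure

open RingTheory.Sequence

universe u v

variable {R : Type u} [CommRing R] [IsLocalRing R] [IsNoetherianRing R]

theorem eq_zero_of_sm {ys : List R} (hys : ∀ y ∈ ys, y ∈ maximalIdeal R) {C : Type v}
    [AddCommGroup C] [Module R C] [Module.Finite R C] (hC : IsWeaklyRegular C ys)
    {P E : Type*} [AddCommGroup P] [Module R P] [Module.Finite R P] [AddCommGroup E] [Module R E]
    [Module.Finite R E] (hE : Sm R (ys.length + 1) E) (φ : P →ₗ[R] C) (ψ : P →ₗ[R] E)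
    (h : ∀ p, ψ p = 0 → φ p = 0) (p : P) : φ p = 0 := by
  rw [← Submodule.mem_bot R, ← eq_bot_of_isWeaklyRegular hys hC (LinearMap.range φ)]
  · exact LinearMap.mem_range_self _ _
  · refine hE.of_ker_le φ.rangeRestrict φ.surjective_rangeRestrict ψ fun p hp => ?_
    rw [LinearMap.ker_rangeRestrict]
    exact h p hp

theorem star_quotient_pow {N : Type v} [AddCommGroup N] [Module R N] [Module.Finite R N]
    {a : R} {xs : List R} (hQ : FinCol (Ideal.ofList (a :: xs) • (⊤ : Submodule R N)))
    (h : Star (a :: xs) N) (ha : IsSMulRegular N a) (n : ℕ) :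
    FinCol (Ideal.ofList xs • (⊤ : Submodule R (QuotSMulTop (a ^ n) N))) ∧
      Star xs (QuotSMulTop (a ^ n) N) := by
  have hfin : ∀ n, FinCol (Ideal.ofList xs • (⊤ : Submodule R (QuotSMulTop (a ^ n) N))) := by
    intro n
    refine finCol_of_comap_surjective (Submodule.mkQ_surjective _) ?_
    rw [comap_mkQ_smul_top]
    refine (hQ.pow_smul_top n).mono ?_
    rw [Ideal.ofList_cons, sup_comm]
    refine (Submodule.smul_mono (sup_pow_le_sup _ _ n) le_rfl).trans ?_
    rw [Submodule.sup_smul, Ideal.span_singleton_pow, Submodule.ideal_span_singleton_smul, sup_comm]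
  refine ⟨hfin n, ?_⟩
  induction n with
  | zero =>
    have : Subsingleton (QuotSMulTop (a ^ 0) N) := by
      rw [Submodule.Quotient.subsingleton_iff, pow_zero, one_smul]
    exact Star.of_subsingleton xs
  | succ n ih =>
    have hmem : ∀ (k : ℕ) (x : N), x ∈ a ^ k • (⊤ : Submodule R N) ↔ ∃ y, a ^ k • y = x := by
      intro k x
      simp [Submodule.mem_smul_pointwise_iff_exists]
    let f : QuotSMulTop a N →ₗ[R] QuotSMulTop (a ^ (n + 1)) N :=
      Submodule.mapQ _ _ (LinearMap.lsmul R N (a ^ n)) fun x hx => by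
        obtain ⟨y, -, rfl⟩ := (Submodule.mem_smul_pointwise_iff_exists _ _ _).1 hx
        rw [Submodule.mem_comap, hmem]
        exact ⟨y, by rw [LinearMap.lsmul_apply, smul_smul, pow_succ]⟩
    let g : QuotSMulTop (a ^ (n + 1)) N →ₗ[R] QuotSMulTop (a ^ n) N :=
      Submodule.factor fun x hx => by
        rw [hmem] at hx ⊢
        obtain ⟨y, rfl⟩ := hx
        exact ⟨a • y, by rw [smul_smul, pow_succ]⟩
    refine Star.of_exact (hfin (n + 1)) (finCol_quotient_of_cons le_rfl hQ) (h.quotient hQ ha) ih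
      f g ?_ ?_ ?_
    · rw [injective_iff_map_eq_zero]
      intro x hx
      obtain ⟨x, rfl⟩ := Submodule.Quotient.mk_surjective _ x
      have hx' : a ^ n • x ∈ a ^ (n + 1) • (⊤ : Submodule R N) :=
        (Submodule.Quotient.mk_eq_zero _).1 hx
      rw [hmem] at hx'
      obtain ⟨y, hy⟩ := hx'
      refine (Submodule.Quotient.mk_eq_zero _).2
        ((Submodule.mem_smul_pointwise_iff_exists _ _ _).2 ⟨y, trivial, ha.pow n ?_⟩)
      change a ^ n • a • y = a ^ n • x
      rw [smul_smul, ← pow_succ, hy]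
    · intro x
      obtain ⟨x, rfl⟩ := Submodule.Quotient.mk_surjective _ x
      constructor
      · intro hx
        have hx' : x ∈ a ^ n • (⊤ : Submodule R N) := (Submodule.Quotient.mk_eq_zero _).1 hx
        rw [hmem] at hx'
        obtain ⟨y, rfl⟩ := hx'
        exact ⟨Submodule.Quotient.mk y, rfl⟩
      · rintro ⟨y, hy⟩
        obtain ⟨y, rfl⟩ := Submodule.Quotient.mk_surjective _ y
        rw [← hy]
        exact (Submodule.Quotient.mk_eq_zero _).2 ((hmem _ _).2 ⟨y, rfl⟩)
    · exact Submodule.factor_surjective _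

end Structure

section Structure

open RingTheory.Sequence

universe u v

variable {R : Type u} [CommRing R] [IsLocalRing R] [IsNoetherianRing R]

theorem exists_small_submodule_of_isSMulRegular {a : R} {xs : List R}
    (hxs : ∀ x ∈ a :: xs, x ∈ maximalIdeal R)
    (ih : ∀ {M : Type v} [AddCommGroup M] [Module R M] [Module.Finite R M], LinCompact R M →
      FinCol (Ideal.ofList xs • (⊤ : Submodule R M)) → Star xs M →
        ∃ U : Submodule R M, Sm R xs.length U ∧ IsWeaklyRegular (M ⧸ U) xs)
    {N : Type v} [AddCommGroup N] [Module R N] [Module.Finite R N] (hN : LinCompact R N)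
    (hQ : FinCol (Ideal.ofList (a :: xs) • (⊤ : Submodule R N))) (h : Star (a :: xs) N)
    (ha : IsSMulRegular N a) :
    ∃ W : Submodule R N, Sm R (a :: xs).length W ∧ IsWeaklyRegular (N ⧸ W) (a :: xs) := by
  have ham : a ∈ maximalIdeal R := hxs a List.mem_cons_self
  have hxs' : ∀ x ∈ xs, x ∈ maximalIdeal R := fun x hx => hxs x (List.mem_cons_of_mem _ hx)
  have hmem : ∀ (k : ℕ) (x : N), x ∈ a ^ k • (⊤ : Submodule R N) ↔ ∃ y, a ^ k • y = x := by
    intro k x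
    simp [Submodule.mem_smul_pointwise_iff_exists]
  have key : ∀ n, ∃ V : Submodule R N, a ^ n • (⊤ : Submodule R N) ≤ V ∧
      IsWeaklyRegular (N ⧸ V) xs ∧
      Sm R xs.length (V.map (a ^ n • (⊤ : Submodule R N)).mkQ) := by
    intro n
    obtain ⟨hfin, hstar⟩ := star_quotient_pow hQ h ha n
    obtain ⟨U, hU, hreg⟩ := ih (hN.quotient (a ^ n • (⊤ : Submodule R N))) hfin hstar
    refine ⟨U.comap (Submodule.mkQ _), fun x hx => ?_, ?_, ?_⟩
    · rw [Submodule.mem_comap, Submodule.mkQ_apply, (Submodule.Quotient.mk_eq_zero _).2 hx]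
      exact U.zero_mem
    · exact ((quotientComapEquiv _ U).isWeaklyRegular_congr xs).1 hreg
    · rwa [Submodule.map_comap_eq_of_surjective (Submodule.mkQ_surjective _)]
  choose V hle hreg hsm using key
  let ψ : ∀ n, V n →ₗ[R] (V n).map (a ^ n • (⊤ : Submodule R N)).mkQ := fun n =>
    (a ^ n • (⊤ : Submodule R N)).mkQ.restrict fun x hx => ⟨x, hx, rfl⟩
  have hψ : ∀ n (z : V n), ψ n z = 0 → ∃ y, a ^ n • y = (z : N) := fun n z hz =>
    (hmem n z).1 ((Submodule.Quotient.mk_eq_zero _).1 (congrArg Subtype.val hz))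
  have hψs : ∀ n, Function.Surjective (ψ n) := by
    rintro n ⟨_, x, hx, rfl⟩
    exact ⟨⟨x, hx⟩, rfl⟩
  have hmemV : ∀ n y, a ^ n • y ∈ V n := fun n y => hle n ((hmem n _).2 ⟨y, rfl⟩)
  have hsucc : ∀ n, V (n + 1) ≤ V n := fun n z hz => by
    refine (Submodule.Quotient.mk_eq_zero _).1 (eq_zero_of_sm hxs' (hreg n) (hsm (n + 1)).succ
      ((V n).mkQ ∘ₗ (V (n + 1)).subtype) (ψ (n + 1)) (fun p hp => ?_) ⟨z, hz⟩)
    obtain ⟨y, hy⟩ := hψ _ p hp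
    refine (Submodule.Quotient.mk_eq_zero _).2 ?_
    change (p : N) ∈ V n
    rw [← hy, pow_succ, mul_smul]
    exact hmemV n _
  have hanti : Antitone V := antitone_nat_of_succ_le hsucc
  have hcolon : ∀ n z, a • z ∈ V (n + 1) → z ∈ V n := fun n z hz => by
    let P : Submodule R N := (V (n + 1)).comap (LinearMap.lsmul R N a)
    refine (Submodule.Quotient.mk_eq_zero _).1 (eq_zero_of_sm hxs' (hreg n) (hsm (n + 1)).succ
      ((V n).mkQ ∘ₗ P.subtype)
      (ψ (n + 1) ∘ₗ (LinearMap.lsmul R N a).restrict (p := P) (q := V (n + 1)) fun x hx => hx)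
      (fun p hp => ?_) ⟨z, hz⟩)
    obtain ⟨y, hy⟩ := hψ _ _ hp
    refine (Submodule.Quotient.mk_eq_zero _).2 ?_
    change (p : N) ∈ V n
    have h1 : a ^ n • y = (p : N) := by
      apply ha
      change a • a ^ n • y = a • (p : N)
      rw [smul_smul, ← pow_succ', hy]
      rfl
    rw [← h1]
    exact hmemV n _
  have hmul : ∀ n z, z ∈ V n → a • z ∈ V (n + 1) := fun n z hz => by
    refine (Submodule.Quotient.mk_eq_zero _).1 (eq_zero_of_sm hxs' (hreg (n + 1)) (hsm n).succ
      ((V (n + 1)).mkQ ∘ₗ LinearMap.lsmul R N a ∘ₗ (V n).subtype) (ψ n) (fun p hp => ?_) ⟨z, hz⟩)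
    obtain ⟨y, hy⟩ := hψ _ p hp
    refine (Submodule.Quotient.mk_eq_zero _).2 ?_
    change a • (p : N) ∈ V (n + 1)
    rw [← hy, smul_smul, ← pow_succ']
    exact hmemV (n + 1) _
  have haV : ∀ z, a • z ∈ V 1 := fun z => by simpa using hmemV 1 z
  have hsup : ∀ n, V 1 ≤ V (n + 1) ⊔ a • (⊤ : Submodule R N) := by
    intro n v hv
    have hV1 : V (n + 1) ≤ V 1 := hanti (by omega)
    let K : Submodule R (N ⧸ V (n + 1)) := (V 1).map (V (n + 1)).mkQ
    have hK : IsWeaklyRegular K xs := by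
      refine isWeaklyRegular_kernel (hreg (n + 1)) (hreg 1) K.subtype (Submodule.factor hV1)
        K.injective_subtype (fun x => ?_) (Submodule.factor_surjective _)
      obtain ⟨x, rfl⟩ := Submodule.Quotient.mk_surjective _ x
      constructor
      · intro hx
        have hx' : x ∈ V 1 := (Submodule.Quotient.mk_eq_zero _).1 hx
        exact ⟨⟨_, x, hx', rfl⟩, rfl⟩
      · rintro ⟨⟨_, y, hy, rfl⟩, hxy⟩
        rw [← hxy]
        exact (Submodule.Quotient.mk_eq_zero _).2 hy
    let f : (N ⧸ V n) →ₗ[R] K := LinearMap.codRestrict K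
      (Submodule.mapQ (V n) (V (n + 1)) (LinearMap.lsmul R N a) fun z hz => hmul n z hz) fun z => by
        obtain ⟨z, rfl⟩ := Submodule.Quotient.mk_surjective _ z
        exact ⟨a • z, haV z, rfl⟩
    have hf : Function.Injective f := by
      rw [injective_iff_map_eq_zero]
      intro z hz
      obtain ⟨z, rfl⟩ := Submodule.Quotient.mk_surjective _ z
      have h1 : a • z ∈ V (n + 1) :=
        (Submodule.Quotient.mk_eq_zero _).1 (congrArg Subtype.val hz)
      exact (Submodule.Quotient.mk_eq_zero _).2 (hcolon n z h1)
    let q : V 1 →ₗ[R] K := (V (n + 1)).mkQ.restrict fun x hx => ⟨x, hx, rfl⟩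
    have hq : Function.Surjective q := by
      rintro ⟨_, x, hx, rfl⟩
      exact ⟨⟨x, hx⟩, rfl⟩
    have hfs : Function.Surjective f := by
      refine surjective_of_isWeaklyRegular hxs' (hreg n) hK f hf ?_
      refine (hsm 1).of_ker_le ((LinearMap.range f).mkQ ∘ₗ q)
        ((Submodule.mkQ_surjective _).comp hq) (ψ 1) fun p hp => ?_
      obtain ⟨y, hy⟩ := hψ 1 p hp
      rw [pow_one] at hy
      refine (Submodule.Quotient.mk_eq_zero _).2 ⟨Submodule.Quotient.mk y, Subtype.ext ?_⟩
      change Submodule.Quotient.mk (a • y) = Submodule.Quotient.mk (p : N)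
      rw [hy]
    obtain ⟨w, hw⟩ := hfs (q ⟨v, hv⟩)
    obtain ⟨w, rfl⟩ := Submodule.Quotient.mk_surjective _ w
    have h1 : a • w - v ∈ V (n + 1) := by
      rw [← Submodule.Quotient.eq]
      exact congrArg Subtype.val hw
    refine Submodule.mem_sup.2 ⟨-(a • w - v), neg_mem h1, a • w, ?_, by abel⟩
    exact (Submodule.mem_smul_pointwise_iff_exists _ _ _).2 ⟨w, trivial, rfl⟩
  set W : Submodule R N := ⨅ n, V n with hW
  have hmemW : ∀ z, z ∈ W ↔ ∀ n, z ∈ V n := fun z => Submodule.mem_iInf _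
  have hWV : V 1 = W ⊔ a • (⊤ : Submodule R N) := by
    apply le_antisymm
    · refine le_trans (le_iInf fun n => ?_) (hN V hanti _)
      rcases n with _ | n
      · have h0 : (⊤ : Submodule R N) ≤ V 0 := by simpa using hle 0
        exact (le_top.trans h0).trans le_sup_left
      · exact hsup n
    · refine sup_le (iInf_le V 1) fun z hz => ?_
      obtain ⟨y, -, rfl⟩ := (Submodule.mem_smul_pointwise_iff_exists _ _ _).1 hz
      exact haV y
  have hWreg : ∀ z, a • z ∈ W → z ∈ W := fun z hz => by
    rw [hmemW] at hz ⊢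
    exact fun n => hcolon n z (hz (n + 1))
  refine ⟨W, ?_, ?_⟩
  · refine Sm.of_quotSMulTop (a := a) ?_ ham
    refine (hsm 1).of_ker_le (a • (⊤ : Submodule R W)).mkQ (Submodule.mkQ_surjective _)
      (ψ 1 ∘ₗ Submodule.inclusion (iInf_le V 1)) fun w hw => ?_
    obtain ⟨y, hy⟩ := hψ 1 _ hw
    rw [pow_one] at hy
    have hyw : a • y = (w : N) := hy
    rw [Submodule.ker_mkQ]
    exact (Submodule.mem_smul_pointwise_iff_exists _ _ _).2
      ⟨⟨y, hWreg y (hyw ▸ w.2)⟩, trivial, Subtype.ext hyw⟩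
  · rw [isWeaklyRegular_cons_iff]
    refine ⟨(isSMulRegular_quotient_iff_mem_of_smul_mem _ _).2 hWreg, ?_⟩
    refine ((equivOfKerEq (f := (V 1).mkQ)
      (g := (a • (⊤ : Submodule R (N ⧸ W))).mkQ ∘ₗ W.mkQ) (Submodule.mkQ_surjective _)
      ((Submodule.mkQ_surjective _).comp (Submodule.mkQ_surjective _))
      ?_).isWeaklyRegular_congr xs).1 (hreg 1)
    rw [LinearMap.ker_comp, Submodule.ker_mkQ, Submodule.ker_mkQ, hWV,
      ← Submodule.ideal_span_singleton_smul, ← Submodule.ideal_span_singleton_smul,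
      comap_mkQ_smul_top]

/-- Modules whose Hilbert function agrees with its leading term up to order `d - 2` have a small
submodule modulo which the parameters form a weakly regular sequence. -/
theorem exists_small_submodule {xs : List R} (hxs : ∀ x ∈ xs, x ∈ maximalIdeal R) :
    ∀ {M : Type v} [AddCommGroup M] [Module R M] [Module.Finite R M], LinCompact R M →
      FinCol (Ideal.ofList xs • (⊤ : Submodule R M)) → Star xs M →
        ∃ U : Submodule R M, Sm R xs.length U ∧ IsWeaklyRegular (M ⧸ U) xs := by
  induction xs with
  | nil => exact fun _ _ _ => ⟨⊥, Sm.of_subsingleton _, IsWeaklyRegular.nil _ _⟩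
  | cons a xs ih =>
    intro M _ _ _ hM hQ h
    obtain ⟨K, -, hK, hmax⟩ := exists_le_maximal_of_wellFoundedGT
      (fun K : Submodule R M => Sm R (a :: xs).length K ∧ Star (a :: xs) (M ⧸ K)) ⊥
      ⟨Sm.of_subsingleton _, h.congr (Submodule.quotEquivOfEqBot ⊥ rfl).symm⟩
    have hQK := finCol_quotient K hQ
    obtain ⟨hL, hstar⟩ := hK.2.torsion hQK hxs List.mem_cons_self
    set L := LinearMap.ker (LinearMap.lsmul R (M ⧸ K) a) with hLdef
    have hKL : K ≤ L.comap K.mkQ := fun x hx => by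
      rw [Submodule.mem_comap, Submodule.mkQ_apply, (Submodule.Quotient.mk_eq_zero _).2 hx]
      exact L.zero_mem
    have hLK := hmax ⟨hK.1.comap_mkQ hL, hstar.congr (quotientComapEquiv K L)⟩ hKL
    have hreg : IsSMulRegular (M ⧸ K) a := by
      refine (isSMulRegular_quotient_iff_mem_of_smul_mem _ _).2 fun x hx => hLK ?_
      exact LinearMap.mem_ker.2 ((Submodule.Quotient.mk_eq_zero _).2 hx)
    obtain ⟨W, hW, hWreg⟩ := exists_small_submodule_of_isSMulRegular hxs
      (ih fun x hx => hxs x (List.mem_cons_of_mem _ hx)) (hM.quotient K) hQK hK.2 hreg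
    exact ⟨W.comap K.mkQ, hK.1.comap_mkQ hW,
      ((quotientComapEquiv K W).isWeaklyRegular_congr _).1 hWreg⟩

end Structure

section Completion

/-- Finitely generated modules over a complete ring are precomplete. -/
theorem isPrecomplete_of_finite {S : Type*} [CommRing S] (I : Ideal S) [IsAdicComplete I S]
    (N : Type*) [AddCommGroup N] [Module S N] [Module.Finite S N] : IsPrecomplete I N := by
  rw [← AdicCompletion.of_surjective_iff]
  intro y
  obtain ⟨t, rfl⟩ := AdicCompletion.ofTensorProduct_surjective_of_finite I N y
  change AdicCompletion.ofTensorProduct I N t ∈ LinearMap.range (AdicCompletion.of I N)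
  induction t using TensorProduct.induction_on with
  | zero => simp
  | tmul a z =>
    obtain ⟨s, rfl⟩ := AdicCompletion.of_surjective I S a
    refine ⟨s • z, ?_⟩
    rw [AdicCompletion.ofTensorProduct_tmul]
    rw [map_smul]
    ext n
    rfl
  | add a b ha hb => rw [map_add]; exact add_mem ha hb

/-- The completion of a Noetherian local ring is Noetherian. -/
theorem isNoetherianRing_adicCompletion (R : Type*) [CommRing R] [IsLocalRing R]
    [IsNoetherianRing R] : IsNoetherianRing (AdicCompletion (maximalIdeal R) R) := by
  obtain ⟨n, a, ha⟩ := Submodule.fg_iff_exists_fin_generating_family.mp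
    (maximalIdeal R).fg_of_isNoetherianRing
  let C := AdicCompletion (maximalIdeal R) R
  let P := MvPolynomial (Fin n) R
  let J : Ideal P := MvPolynomial.idealOfVars (Fin n) R
  have hJ : J.FG := MvPolynomial.idealOfVars_fg (Fin n) R
  let A := AdicCompletion J P
  have hA : IsNoetherianRing A :=
    isNoetherianRing_of_ringEquiv _ (MvPowerSeries.toAdicCompletionAlgEquiv (Fin n) R).toRingEquiv
  let g : P →+* C := (MvPolynomial.aeval (fun i => algebraMap R C (a i)) : P →ₐ[R] C).toRingHom
  have hg : J.map g = maximalIdeal C := by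
    have ha' : (maximalIdeal R).map (algebraMap R C) =
        (Ideal.span (Set.range a)).map (algebraMap R C) := congrArg _ ha.symm
    refine Eq.trans ?_ (ha'.symm.trans AdicCompletion.maximalIdeal_eq_map.symm)
    change (Ideal.span (Set.range MvPolynomial.X)).map g = _
    rw [Ideal.map_span, Ideal.map_span, ← Set.range_comp, ← Set.range_comp]
    congr 2
    ext1 i
    simp [g]
  have hle (k : ℕ) : J ^ k ≤ (maximalIdeal C ^ k).comap g := by
    rw [← Ideal.map_le_iff_le_comap, Ideal.map_pow, hg]
  let f (k : ℕ) : A →+* C ⧸ maximalIdeal C ^ k :=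
    (Ideal.quotientMap (maximalIdeal C ^ k) g (hle k)).comp
      (AdicCompletion.evalₐ J k : A →+* P ⧸ J ^ k)
  have hf {i j : ℕ} (hij : i ≤ j) :
      (Ideal.Quotient.factorPow (maximalIdeal C) hij).comp (f j) = f i := by
    ext1 x
    obtain ⟨y, rfl⟩ := AdicCompletion.mk_surjective J P x
    have hfy (k : ℕ) : f k (AdicCompletion.mk J P y) = Ideal.Quotient.mk _ (g (y.val k)) :=
      congrArg (Ideal.quotientMap (maximalIdeal C ^ k) g (hle k))
        (AdicCompletion.evalₐ_mk J k y)
    rw [RingHom.comp_apply, hfy, hfy]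
    change Ideal.Quotient.mk (maximalIdeal C ^ i) (g (y.val j)) = _
    rw [Ideal.Quotient.eq, ← map_sub]
    refine hle i ?_
    rw [← Ideal.Quotient.eq]
    have h := (y.2 hij).symm
    rw [SModEq.sub_mem, smul_eq_mul, Ideal.mul_top] at h
    rwa [Ideal.Quotient.eq]
  let F : A →+* C := IsAdicComplete.liftRingHom (maximalIdeal C) f hf
  have hF (p : P) : F (algebraMap P A p) = g p := by
    rw [← sub_eq_zero]
    refine IsHausdorff.haus
      (inferInstance : IsAdicComplete (maximalIdeal C) C).toIsHausdorff _ fun k => ?_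
    rw [SModEq.zero, smul_eq_mul, Ideal.mul_top, ← Ideal.Quotient.eq,
      IsAdicComplete.mk_liftRingHom]
    simp only [f, RingHom.comp_apply, RingHom.coe_coe]
    rw [AdicCompletion.algebraMap_apply, AdicCompletion.evalₐ_of]
    rfl
  have hmap : (J.map (algebraMap P A)).map F = maximalIdeal C := by
    rw [Ideal.map_map, ← hg, show F.comp (algebraMap P A) = g from RingHom.ext hF]
  have : IsAdicComplete (J.map (algebraMap P A)) A := AdicCompletion.isAdicComplete_self J hJ
  refine isNoetherianRing_of_surjective A C F ?_
  have : IsHausdorff ((J.map (algebraMap P A)).map F) C := by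
    rw [hmap]
    exact (inferInstance : IsAdicComplete (maximalIdeal C) C).toIsHausdorff
  refine surjective_of_mk_map_comp_surjective (I := J.map (algebraMap P A)) F ?_
  rw [hmap]
  intro y
  obtain ⟨c, rfl⟩ := Ideal.Quotient.mk_surjective y
  obtain ⟨s, hs⟩ := (AdicCompletion.residueField_map_bijective R).2 (residue C c)
  obtain ⟨s, rfl⟩ := residue_surjective s
  refine ⟨algebraMap P A (MvPolynomial.C s), ?_⟩
  rw [RingHom.comp_apply, hF]
  rw [IsLocalRing.ResidueField.map_residue] at hs
  refine Eq.trans (congrArg _ ?_) hs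
  exact MvPolynomial.aeval_C _ _

/-- Chevalley's theorem for finitely generated modules over a complete local ring. -/
theorem exists_le_iInf_sup {S : Type*} [CommRing S] [IsLocalRing S] [IsNoetherianRing S]
    [IsAdicComplete (maximalIdeal S) S] {N : Type*} [AddCommGroup N] [Module S N]
    [Module.Finite S N] {V : ℕ → Submodule S N} (hV : Antitone V) (k : ℕ) :
    ∃ n, V n ≤ (⨅ n, V n) ⊔ maximalIdeal S ^ k • (⊤ : Submodule S N) := by
  let T (k : ℕ) : Submodule S N := maximalIdeal S ^ k • ⊤
  have hT : Antitone T := fun i j h => Submodule.smul_mono_left (Ideal.pow_le_pow_right h)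
  have hstab (j : ℕ) : ∃ n, ∀ i, V n ⊔ T j ≤ V i ⊔ T j := by
    have hfin : FinCol (T j) := finCol_pow_maximalIdeal_smul j
    obtain ⟨n, hn⟩ : ∃ n, ∀ i, cl (V n ⊔ T j) ≥ cl (V i ⊔ T j) := by
      have hbd : ∀ i, cl (V i ⊔ T j) ≤ cl (T j) := fun i => cl_mono hfin le_sup_right
      obtain ⟨_, ⟨n, rfl⟩, hn⟩ := Nat.lt_wfRel.wf.has_min
        (Set.range fun i => cl (T j) - cl (V i ⊔ T j)) ⟨_, 0, rfl⟩
      refine ⟨n, fun i => ?_⟩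
      have h1 : ¬ cl (T j) - cl (V i ⊔ T j) < cl (T j) - cl (V n ⊔ T j) := hn _ ⟨i, rfl⟩
      have h2 := hbd i
      have h3 := hbd n
      omega
    refine ⟨n, fun i => ?_⟩
    rcases le_total n i with h | h
    · refine (eq_of_cl_le (hfin.mono le_sup_right) ?_ (hn i)).ge
      exact sup_le_sup_right (hV h) _
    · exact sup_le_sup_right (hV h) _
  choose ν hν using hstab
  let W (j : ℕ) : Submodule S N := V (ν j) ⊔ T j
  have hW (j i : ℕ) : W j ≤ V i ⊔ T j := hν j i
  have hWstep (j : ℕ) : ∀ y ∈ W j, ∃ y' ∈ W (j + 1), y' - y ∈ T j := by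
    intro y hy
    obtain ⟨v, hv, t, ht, rfl⟩ := Submodule.mem_sup.mp (hW j (ν (j + 1)) hy)
    exact ⟨v, le_sup_left (a := V (ν (j + 1))) hv, by simpa using neg_mem ht⟩
  refine ⟨ν k, fun y hy => ?_⟩
  choose! σ hσ hσ' using hWstep
  let s : ℕ → N := fun i => Nat.rec y (fun i z => σ (k + i) z) i
  have hs (i : ℕ) : s i ∈ W (k + i) := by
    induction i with
    | zero => exact le_sup_left (a := V (ν k)) hy
    | succ i ih => exact hσ _ _ ih
  have hs' (i : ℕ) : s (i + 1) - s i ∈ T (k + i) := hσ' _ _ (hs i)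
  have hcau {i j : ℕ} (hij : i ≤ j) : s j - s i ∈ T (k + i) := by
    induction j, hij using Nat.le_induction with
    | base => simp
    | succ j hij ih =>
      have := add_mem (hT (by omega : k + i ≤ k + j) (hs' j)) ih
      simpa using this
  obtain ⟨L, hL⟩ := (isPrecomplete_of_finite (maximalIdeal S) N).prec (f := s) fun {i j} hij => by
    rw [SModEq.comm, SModEq.sub_mem]
    exact hT (by omega) (hcau hij)
  have hL' (i : ℕ) : s i - L ∈ T i := by
    have := hL i
    rwa [SModEq.sub_mem] at this
  have hLk (i : ℕ) : s i - L ∈ T (k + i) := by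
    have := sub_mem (hL' (k + i)) (hcau (by omega : i ≤ k + i))
    simpa using this
  have hmem : L ∈ ⨅ n, V n := by
    rw [Submodule.mem_iInf]
    intro n
    have hclosed := Ideal.iInf_pow_smul_eq_bot_of_isLocalRing (M := N ⧸ V n) (maximalIdeal S)
      (Ideal.IsPrime.ne_top')
    rw [← Submodule.Quotient.mk_eq_zero, ← Submodule.mem_bot S, ← hclosed, Submodule.mem_iInf]
    intro i
    have h1 : L ∈ V n ⊔ T i := by
      have h2 := hT (by omega : i ≤ k + i) (hLk i)
      have h3 := hW (k + i) n (hs i)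
      have h4 := sub_mem (sup_le_sup_left (hT (by omega : i ≤ k + i)) (V n) h3)
        (le_sup_right (a := V n) h2)
      simpa using h4
    obtain ⟨v, hv, t, ht, hvt⟩ := Submodule.mem_sup.mp h1
    have h5 : (Submodule.Quotient.mk L : N ⧸ V n) = (V n).mkQ t := by
      rw [← hvt]
      simpa using hv
    rw [h5]
    exact pow_smul_top_le_comap (maximalIdeal S) i (V n).mkQ ht
  exact Submodule.mem_sup.mpr ⟨L, hmem, y - L, hLk 0, by simp⟩

theorem linCompact_of_isAdicComplete {S : Type*} [CommRing S] [IsLocalRing S] [IsNoetherianRing S]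
    [IsAdicComplete (maximalIdeal S) S] (N : Type*) [AddCommGroup N] [Module S N]
    [Module.Finite S N] : LinCompact S N := by
  intro V hV B x hx
  have hclosed := Ideal.iInf_pow_smul_eq_bot_of_isLocalRing (M := N ⧸ ((⨅ n, V n) ⊔ B))
    (maximalIdeal S) (Ideal.IsPrime.ne_top')
  rw [← Submodule.Quotient.mk_eq_zero, ← Submodule.mem_bot S, ← hclosed, Submodule.mem_iInf]
  intro k
  obtain ⟨n, hn⟩ := exists_le_iInf_sup hV k
  have h1 : x ∈ ((⨅ n, V n) ⊔ B) ⊔ maximalIdeal S ^ k • (⊤ : Submodule S N) := by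
    have hle : V n ⊔ B ≤ ((⨅ n, V n) ⊔ B) ⊔ maximalIdeal S ^ k • (⊤ : Submodule S N) :=
      sup_le (hn.trans (sup_le_sup_right le_sup_left _)) (le_sup_right.trans le_sup_left)
    exact hle ((Submodule.mem_iInf _).mp hx n)
  obtain ⟨v, hv, t, ht, hvt⟩ := Submodule.mem_sup.mp h1
  have h5 : (Submodule.Quotient.mk x : N ⧸ ((⨅ n, V n) ⊔ B)) = ((⨅ n, V n) ⊔ B).mkQ t := by
    rw [← hvt]
    simpa using hv
  rw [h5]
  exact pow_smul_top_le_comap (maximalIdeal S) k _ ht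

end Completion

section Dimension

variable {S : Type*} [CommRing S] [IsLocalRing S] [IsNoetherianRing S]

theorem Sm.quotient_of_lt {p q : Ideal S} [hp : p.IsPrime] (hpq : p < q) {s : ℕ}
    (h : Sm S (s + 1) (S ⧸ p)) : Sm S s (S ⧸ q) := by
  obtain ⟨a, haq, hap⟩ := SetLike.exists_of_lt hpq
  have hr : IsSMulRegular (S ⧸ p) a := by
    rw [isSMulRegular_quotient_iff_mem_of_smul_mem]
    intro x hx
    exact (hp.mem_or_mem hx).resolve_left hap
  refine (h.quotSMulTop hr).of_ker_le q.mkQ q.mkQ_surjective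
    ((a • (⊤ : Submodule S (S ⧸ p))).mkQ ∘ₗ p.mkQ) fun x hx => ?_
  rw [LinearMap.mem_ker, LinearMap.comp_apply, ← LinearMap.mem_ker, Submodule.ker_mkQ,
    Submodule.mem_smul_pointwise_iff_exists] at hx
  obtain ⟨y, -, hy⟩ := hx
  obtain ⟨y, rfl⟩ := p.mkQ_surjective y
  rw [← map_smul, ← sub_eq_zero, ← map_sub, ← LinearMap.mem_ker, Submodule.ker_mkQ] at hy
  rw [Submodule.ker_mkQ]
  have := sub_mem (q.mul_mem_right y haq) (hpq.le hy)
  simpa using this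

theorem not_sm_quotient_head (n : ℕ) (l : LTSeries (PrimeSpectrum S)) (hl : l.length = n) :
    ¬ Sm S (n + 1) (S ⧸ l.head.asIdeal) := by
  induction n generalizing l with
  | zero =>
    intro h
    have := h.subsingleton
    exact l.head.isPrime.ne_top (Ideal.Quotient.subsingleton_iff.mp this)
  | succ n ih =>
    intro h
    have hne : l.length ≠ 0 := by omega
    refine ih (l.tail hne) (by simp [hl]) ?_
    refine h.quotient_of_lt ?_
    rw [RelSeries.head_tail]
    exact PrimeSpectrum.asIdeal_lt_asIdeal _ _ |>.mpr (l.strictMono (by simp [Fin.lt_def, hl]))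

/-- The Hilbert function of `S ⧸ p` grows at least like a polynomial of degree `dim S ⧸ p`. -/
theorem not_sm_of_ringKrullDim {p : Ideal S} {r : ℕ} (hp : ringKrullDim (S ⧸ p) = (r : ℕ∞)) :
    ¬ Sm S (r + 1) (S ⧸ p) := by
  intro h
  rw [ringKrullDim_quotient] at hp
  obtain ⟨l, hl⟩ := Order.le_krullDim_iff.mp (show ((r : ℕ) : WithBot ℕ∞) ≤ _ from hp.ge)
  have hle : p ≤ l.head.1.asIdeal := l.head.2
  exact not_sm_quotient_head r (l.map Subtype.val fun _ _ h => h) hl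
    (h.of_surjective (Submodule.factor hle) (Submodule.factor_surjective hle))

theorem Sm.eq_bot_of_associatedPrimes {N : Type*} [AddCommGroup N] [Module S N] [Module.Finite S N]
    {r : ℕ} (hN : ∀ p ∈ associatedPrimes S N, ringKrullDim (S ⧸ p) = (r : ℕ∞))
    {U : Submodule S N} (hU : Sm S r U) : U = ⊥ := by
  by_contra hne
  have : Nontrivial U := Submodule.nontrivial_iff_ne_bot.mpr hne
  obtain ⟨p, hp⟩ := associatedPrimes.nonempty S U
  obtain ⟨-, f, hf⟩ :=
    (isAssociatedPrime_iff_exists_injective_linearMap (I := p) (M := U)).mp hp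
  have hpN := hN p (hp.map_of_injective U.subtype U.injective_subtype)
  exact not_sm_of_ringKrullDim hpN (hU.of_injective f hf).succ

end Dimension

section Coefficients

variable {R : Type*} [CommRing R] [IsLocalRing R] [IsNoetherianRing R]
  {M : Type*} [AddCommGroup M] [Module R M] [Module.Finite R M]

theorem growth_tail (r : ℕ) (c : ℕ → ℕ) :
    Growth 2 r fun n => ∑ i ∈ Finset.Ico 2 (r + 1), c i * Nat.multichoose (r - i + 1) n := by
  refine ⟨∑ i ∈ Finset.Ico 2 (r + 1), c i, fun n => ?_⟩
  rw [Finset.sum_mul, Finset.sum_mul]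
  refine Finset.sum_le_sum fun i hi => ?_
  rw [Finset.mem_Ico] at hi
  rw [mul_assoc]
  refine Nat.mul_le_mul_left _ ?_
  calc _ ≤ (n + 1) ^ (r - i) * (n + 1) ^ 2 := Nat.mul_le_mul_right _ (multichoose_succ_le_pow _ _)
    _ = (n + 1) ^ (r - i + 2) := (pow_add _ _ _).symm
    _ ≤ (n + 1) ^ r := Nat.pow_le_pow_right (Nat.succ_pos n) (by omega)

/-- A Hilbert polynomial whose second coefficient vanishes. -/
theorem star_of_coeff_one_eq_zero {xs : List R} (hr2 : 2 ≤ xs.length)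
    (hQ : FinCol (Ideal.ofList xs • (⊤ : Submodule R M))) {e : ℕ → ℤ} {n₀ : ℕ}
    (he : ∀ n ≥ n₀, (hilb (Ideal.ofList xs) M n : ℤ) =
      ∑ i ∈ Finset.range (xs.length + 1), (-1 : ℤ) ^ i * e i *
        ((n + xs.length - i).choose (xs.length - i) : ℤ)) (he1 : e 1 = 0) :
    Star xs M := by
  generalize hr : xs.length = r at *
  let T : ℕ → ℕ := fun n =>
    ∑ i ∈ Finset.Ico 2 (r + 1), (e i).natAbs * Nat.multichoose (r - i + 1) n
  have hT : Growth 2 r T := growth_tail r _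
  have hcomp : ∀ n ≥ n₀,
      |(hilb (Ideal.ofList xs) M n : ℤ) - e 0 * Nat.multichoose (r + 1) n| ≤ T n := by
    intro n hn
    rw [he n hn, ← Finset.sum_range_add_sum_Ico _ (by omega : 2 ≤ r + 1)]
    have h0 : ∑ i ∈ Finset.range 2, (-1 : ℤ) ^ i * e i * ((n + r - i).choose (r - i) : ℤ) =
        e 0 * Nat.multichoose (r + 1) n := by
      rw [Finset.sum_range_succ, Finset.sum_range_one, he1, Nat.multichoose_eq,
        show r + 1 + n - 1 = n + r by omega, Nat.choose_symm_add]
      simp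
    rw [h0, add_sub_cancel_left]
    refine (Finset.abs_sum_le_sum_abs _ _).trans ?_
    simp only [T]
    push_cast
    refine Finset.sum_le_sum fun i hi => ?_
    rw [Finset.mem_Ico] at hi
    rw [abs_mul, abs_mul, abs_pow, abs_neg, abs_one, one_pow, one_mul, Nat.multichoose_eq,
      show r - i + 1 + n - 1 = n + (r - i) by omega, show n + r - i = n + (r - i) by omega,
      Nat.choose_symm_add, Nat.abs_cast]
  obtain ⟨C, hC⟩ := hT
  have hf : Growth 2 r fun n => if n < n₀ then hilb (Ideal.ofList xs) M n else T n := by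
    refine Growth.of_eventually hr2 (C := C) (N := n₀) fun n hn => ?_
    rw [if_neg (by omega)]
    exact hC n
  have hg : Growth 1 r fun n =>
      if n < n₀ then (e 0).toNat * Nat.multichoose (r + 1) n else T n := by
    refine Growth.of_succ (Growth.of_eventually hr2 (C := C) (N := n₀) fun n hn => ?_)
    rw [if_neg (by omega)]
    exact hC n
  subst hr
  refine Star.of_hilb_le hQ (e := (e 0).toNat) (fun n => ?_) (fun n => ?_) hf hg
  · split_ifs with h
    · exact Nat.le_add_left _ _
    · have h1 := (abs_le.mp (hcomp n (by omega))).2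
      have h2 : e 0 * (Nat.multichoose (xs.length + 1) n : ℤ) ≤
          ((e 0).toNat : ℤ) * (Nat.multichoose (xs.length + 1) n : ℤ) :=
        mul_le_mul_of_nonneg_right (Int.self_le_toNat _) (by positivity)
      zify
      linarith
  · split_ifs with h
    · exact Nat.le_add_left _ _
    · have h1 := (abs_le.mp (hcomp n (by omega))).1
      rcases le_total 0 (e 0) with h0 | h0
      · zify
        rw [Int.toNat_of_nonneg h0]
        linarith
      · rw [Int.toNat_of_nonpos h0]
        simp

end Coefficients

section Transfer

/-- The completion of a module over a local ring. -/
abbrev Completed (R : Type) [CommRing R] [IsLocalRing R] (M : Type) [AddCommGroup M] [Module R M] :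
    Type :=
  AdicCompletion (maximalIdeal R) M

theorem length_eq_of_forall_smul_eq {R S X : Type*} [CommRing R] [CommRing S] [Algebra R S]
    [AddCommGroup X] [Module R X] [Module S X] [IsScalarTower R S X]
    (h : ∀ s : S, ∃ r : R, ∀ x : X, s • x = r • x) : Module.length S X = Module.length R X := by
  let e : Submodule S X ≃o Submodule R X :=
    { toFun := Submodule.restrictScalars R
      invFun := fun A =>
        { A with
          smul_mem' := fun s x hx => by
            obtain ⟨r, hr⟩ := h s
            rw [hr]
            exact A.smul_mem r hx }
      left_inv := fun A => rfl
      right_inv := fun A => rfl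
      map_rel_iff' := Iff.rfl }
  refine WithBot.coe_injective ?_
  rw [Module.coe_length, Module.coe_length]
  exact Order.krullDim_eq_of_orderIso e

variable {R : Type} [CommRing R] [IsLocalRing R] [IsNoetherianRing R]
  {M : Type} [AddCommGroup M] [Module R M] [Module.Finite R M]

theorem finite_adicCompletion : Module.Finite (Completed R R) (Completed R M) :=
  Module.Finite.equiv (AdicCompletion.ofTensorProductEquivOfFiniteNoetherian (maximalIdeal R) M)

theorem comap_of_smul_top (J : Ideal R) :
    (J • (⊤ : Submodule R (Completed R M))).comap (AdicCompletion.of (maximalIdeal R) M) =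
      J • (⊤ : Submodule R M) := by
  refine le_antisymm (fun x hx => ?_) ?_
  · have hclosed := Ideal.iInf_pow_smul_eq_bot_of_isLocalRing
      (M := M ⧸ (J • (⊤ : Submodule R M))) (maximalIdeal R) (Ideal.IsPrime.ne_top')
    rw [← Submodule.Quotient.mk_eq_zero, ← Submodule.mem_bot R, ← hclosed, Submodule.mem_iInf]
    intro k
    have h1 : AdicCompletion.eval (maximalIdeal R) M k (AdicCompletion.of (maximalIdeal R) M x) ∈
        J • (⊤ : Submodule R (M ⧸ (maximalIdeal R ^ k • (⊤ : Submodule R M)))) := by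
      have := Submodule.mem_map_of_mem (f := AdicCompletion.eval (maximalIdeal R) M k)
        (Submodule.mem_comap.mp hx)
      rw [Submodule.map_smul''] at this
      exact Submodule.smul_mono le_rfl le_top this
    change (maximalIdeal R ^ k • (⊤ : Submodule R M)).mkQ x ∈ _ at h1
    rw [← Submodule.mem_comap, comap_mkQ_smul_top] at h1
    obtain ⟨u, hu, v, hv, rfl⟩ := Submodule.mem_sup.mp h1
    have h5 : (Submodule.Quotient.mk (u + v) : M ⧸ (J • (⊤ : Submodule R M))) =
        (J • (⊤ : Submodule R M)).mkQ u := by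
      simpa using hv
    rw [h5]
    exact pow_smul_top_le_comap (maximalIdeal R) k _ hu
  · rw [← Submodule.map_le_iff_le_comap, Submodule.map_smul'']
    exact Submodule.smul_mono le_rfl le_top

theorem restrictScalars_map_smul_top (J : Ideal R) :
    ((J.map (algebraMap R (Completed R R))) •
        (⊤ : Submodule (Completed R R) (Completed R M))).restrictScalars R =
      J • (⊤ : Submodule R (Completed R M)) := by
  rw [Submodule.restrictScalars_map_smul_eq]
  rfl

theorem span_range_of :
    Submodule.span (Completed R R) (Set.range (AdicCompletion.of (maximalIdeal R) M)) = ⊤ := by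
  rw [eq_top_iff]
  intro y _
  obtain ⟨t, rfl⟩ := AdicCompletion.ofTensorProduct_surjective_of_finite (maximalIdeal R) M y
  induction t using TensorProduct.induction_on with
  | zero => simp
  | tmul a z =>
    rw [AdicCompletion.ofTensorProduct_tmul]
    exact Submodule.smul_mem _ _ (Submodule.subset_span ⟨z, rfl⟩)
  | add a b ha hb => rw [map_add]; exact add_mem (ha trivial) (hb trivial)

theorem smul_top_le_smul_top {I J : Ideal R}
    (h : I • (⊤ : Submodule R M) ≤ J • (⊤ : Submodule R M)) :
    I • (⊤ : Submodule R (Completed R M)) ≤ J • (⊤ : Submodule R (Completed R M)) := by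
  rw [Submodule.smul_le]
  intro c hc y _
  have hy : y ∈ Submodule.span (Completed R R)
      (Set.range (AdicCompletion.of (maximalIdeal R) M)) := by
    rw [span_range_of]
    trivial
  induction hy using Submodule.span_induction with
  | mem y hy =>
    obtain ⟨x, rfl⟩ := hy
    rw [← map_smul, ← Submodule.mem_comap, comap_of_smul_top]
    exact h (Submodule.smul_mem_smul hc trivial)
  | zero => simp
  | add y z _ _ hy hz => rw [smul_add]; exact add_mem (hy trivial) (hz trivial)
  | smul s y _ hy =>
    rw [smul_comm, ← restrictScalars_map_smul_top]
    rw [← restrictScalars_map_smul_top] at hy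
    exact Submodule.smul_mem _ s (hy trivial)

theorem range_of_sup_smul_top {J : Ideal R} {k : ℕ}
    (hk : maximalIdeal R ^ k • (⊤ : Submodule R M) ≤ J • ⊤) :
    LinearMap.range (AdicCompletion.of (maximalIdeal R) M) ⊔
      J • (⊤ : Submodule R (Completed R M)) = ⊤ := by
  have hle := smul_top_le_smul_top hk
  rw [eq_top_iff]
  intro y _
  obtain ⟨x, hx⟩ := Submodule.mkQ_surjective _ (AdicCompletion.eval (maximalIdeal R) M k y)
  rw [← sub_add_cancel y (AdicCompletion.of (maximalIdeal R) M x)]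
  refine add_mem (Submodule.mem_sup_right (hle ?_)) (Submodule.mem_sup_left ⟨x, rfl⟩)
  rw [AdicCompletion.pow_smul_top_eq_ker_eval (maximalIdeal R).fg_of_isNoetherianRing,
    LinearMap.mem_ker, map_sub, ← hx]
  exact sub_self _

theorem length_adicCompletion_quotient {J : Ideal R} {k : ℕ}
    (hk : maximalIdeal R ^ k • (⊤ : Submodule R M) ≤ J • ⊤) :
    Module.length (Completed R R) (Completed R M ⧸
        (J.map (algebraMap R (Completed R R)) • (⊤ : Submodule (Completed R R) (Completed R M)))) =
      Module.length R (M ⧸ (J • (⊤ : Submodule R M))) := by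
  let A := J.map (algebraMap R (Completed R R)) • (⊤ : Submodule (Completed R R) (Completed R M))
  have hA : A.restrictScalars R = J • (⊤ : Submodule R (Completed R M)) :=
    restrictScalars_map_smul_top J
  have hrange := range_of_sup_smul_top hk
  have h1 : Module.length (Completed R R) (Completed R M ⧸ A) =
      Module.length R (Completed R M ⧸ A) := by
    refine length_eq_of_forall_smul_eq fun s => ?_
    obtain ⟨r, hr⟩ := Submodule.mkQ_surjective _ (AdicCompletion.eval (maximalIdeal R) R k s)
    have hs : s - algebraMap R (Completed R R) r ∈
        maximalIdeal R ^ k • (⊤ : Submodule R (Completed R R)) := by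
      rw [AdicCompletion.pow_smul_top_eq_ker_eval (maximalIdeal R).fg_of_isNoetherianRing,
        LinearMap.mem_ker, map_sub, ← hr]
      exact sub_self _
    refine ⟨r, fun x => ?_⟩
    rw [← algebraMap_smul (Completed R R) r x, ← sub_eq_zero, ← sub_smul]
    obtain ⟨y, rfl⟩ := A.mkQ_surjective x
    generalize s - algebraMap R (Completed R R) r = d at hs
    induction hs using Submodule.smul_induction_on' with
    | smul c hc d _ =>
      rw [smul_assoc, smul_comm, ← LinearMap.map_smul_of_tower]
      have : A.mkQ (c • y) = 0 := by
        rw [← LinearMap.mem_ker, Submodule.ker_mkQ, ← Submodule.restrictScalars_mem R, hA]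
        exact smul_top_le_smul_top hk (Submodule.smul_mem_smul hc trivial)
      rw [this, smul_zero]
    | add u _ v _ hu hv => rw [add_smul, hu, hv, add_zero]
  rw [h1]
  let f : M →ₗ[R] Completed R M ⧸ A :=
    (A.mkQ.restrictScalars R) ∘ₗ AdicCompletion.of (maximalIdeal R) M
  have hf : Function.Surjective f := by
    intro y
    obtain ⟨y, rfl⟩ := A.mkQ_surjective y
    have hy : y ∈ LinearMap.range (AdicCompletion.of (maximalIdeal R) M) ⊔ A.restrictScalars R := by
      rw [hA, hrange]
      trivial
    obtain ⟨_, ⟨x, rfl⟩, a, ha, rfl⟩ := Submodule.mem_sup.mp hy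
    refine ⟨x, ?_⟩
    simpa [f] using ha
  have hker : LinearMap.ker f = J • (⊤ : Submodule R M) := by
    rw [← comap_of_smul_top J, ← hA]
    ext x
    simp [f]
  rw [← hker]
  exact (LinearMap.quotKerEquivOfSurjective f hf).length_eq.symm

theorem isWeaklyRegular_of_adicCompletion {xs : List R}
    (h : RingTheory.Sequence.IsWeaklyRegular (Completed R M) xs) :
    RingTheory.Sequence.IsWeaklyRegular M xs := by
  refine ⟨fun i hi => ?_⟩
  have h1 := h.regular_mod_prev i hi
  rw [isSMulRegular_quotient_iff_mem_of_smul_mem] at h1 ⊢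
  intro x hx
  rw [← comap_of_smul_top] at hx ⊢
  rw [Submodule.mem_comap] at hx ⊢
  rw [map_smul] at hx
  exact h1 _ hx

theorem FinCol.exists_pow_smul_top_le {A : Submodule R M} (hA : FinCol A) :
    ∃ k, maximalIdeal R ^ k • (⊤ : Submodule R M) ≤ A := by
  have hfin := isFiniteLength_iff_isNoetherian_isArtinian.mp (Module.length_ne_top_iff.mp hA)
  have := hfin.2
  let F : ℕ →o (Submodule R (M ⧸ A))ᵒᵈ :=
    ⟨fun k => OrderDual.toDual (maximalIdeal R ^ k • ⊤),
      fun a b hab => Submodule.smul_mono_left (Ideal.pow_le_pow_right hab)⟩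
  obtain ⟨k, hk⟩ := IsArtinian.monotone_stabilizes F
  have h0 : maximalIdeal R ^ k • (⊤ : Submodule R (M ⧸ A)) = ⊥ := by
    rw [← Ideal.iInf_pow_smul_eq_bot_of_isLocalRing (M := M ⧸ A) (maximalIdeal R)
      Ideal.IsPrime.ne_top']
    refine le_antisymm (le_iInf fun n => ?_) (iInf_le _ k)
    rcases le_total k n with h | h
    · exact le_of_eq (hk n h)
    · exact Submodule.smul_mono_left (Ideal.pow_le_pow_right h)
  refine ⟨k, (pow_smul_top_le_comap (maximalIdeal R) k A.mkQ).trans ?_⟩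
  rw [h0, Submodule.comap_bot, Submodule.ker_mkQ]

theorem hilb_adicCompletion (I : Ideal R) (hI : FinCol (I • (⊤ : Submodule R M))) (n : ℕ) :
    Module.length (Completed R R) (Completed R M ⧸
        ((I.map (algebraMap R (Completed R R))) ^ n •
          (⊤ : Submodule (Completed R R) (Completed R M)))) =
      Module.length R (M ⧸ (I ^ n • (⊤ : Submodule R M))) := by
  obtain ⟨k, hk⟩ : ∃ k, maximalIdeal R ^ k • (⊤ : Submodule R M) ≤ I ^ n • ⊤ :=
    (hI.pow_smul_top n).exists_pow_smul_top_le
  rw [← Ideal.map_pow]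
  exact length_adicCompletion_quotient hk

/-- An unmixed module whose Hilbert function has vanishing second coefficient is Cohen–Macaulay. -/
theorem isWeaklyRegular_of_star {xs : List R} (hxs : ∀ x ∈ xs, x ∈ maximalIdeal R)
    (hQ : FinCol (Ideal.ofList xs • (⊤ : Submodule R M))) (hstar : Star xs M)
    (hu : ∀ p ∈ associatedPrimes (Completed R R) (Completed R M),
      ringKrullDim (Completed R R ⧸ p) = (xs.length : ℕ∞)) :
    RingTheory.Sequence.IsWeaklyRegular M xs := by
  have := isNoetherianRing_adicCompletion R
  have : Module.Finite (Completed R R) (Completed R M) := finite_adicCompletion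
  let ys := xs.map (algebraMap R (Completed R R))
  have hlen : ys.length = xs.length := List.length_map _
  have hys : Ideal.ofList ys = (Ideal.ofList xs).map (algebraMap R (Completed R R)) :=
    (Ideal.map_ofList _ _).symm
  have hQ' : FinCol (Ideal.ofList ys • (⊤ : Submodule (Completed R R) (Completed R M))) := by
    have := hilb_adicCompletion _ hQ 1
    rw [pow_one, pow_one] at this
    rw [FinCol, hys, this]
    exact hQ
  have hstar' : Star ys (Completed R M) := by
    obtain ⟨e, f, h1, h2⟩ := hstar
    refine ⟨e, f, fun n => ?_, by rwa [hlen]⟩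
    rw [hlen, ← h1, hilb, hilb, cl, cl, hys, hilb_adicCompletion _ hQ]
  obtain ⟨U, hU, hreg⟩ := exists_small_submodule (xs := ys) (fun y hy => by
      obtain ⟨x, hx, rfl⟩ := List.mem_map.mp hy
      rw [AdicCompletion.maximalIdeal_eq_map]
      exact Ideal.mem_map_of_mem _ (hxs x hx))
    (linCompact_of_isAdicComplete (Completed R M)) hQ' hstar'
  rw [hlen] at hU
  have hU0 := hU.eq_bot_of_associatedPrimes hu
  rw [(Submodule.quotEquivOfEqBot U hU0).isWeaklyRegular_congr] at hreg
  exact isWeaklyRegular_of_adicCompletion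
    ((RingTheory.Sequence.isWeaklyRegular_map_algebraMap_iff (Completed R R) (Completed R M) xs).mp
      hreg)

end Transfer

section CohenMacaulay

open CategoryTheory Abelian RingTheory.Sequence

variable {R : Type} [CommRing R] [IsLocalRing R] [IsNoetherianRing R]

theorem exists_isRegular_quotSMulTop {M : Type} [AddCommGroup M] [Module R M] [Module.Finite R M]
    {ys : List R} (hys : ∀ y ∈ ys, y ∈ maximalIdeal R) (hreg : IsRegular M ys)
    {x : R} (hx : x ∈ maximalIdeal R) (hxM : IsSMulRegular M x) {d : ℕ} (hd : ys.length = d + 1) :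
    ∃ zs : List R, zs.length = d ∧ (∀ z ∈ zs, z ∈ maximalIdeal R) ∧
      IsRegular (QuotSMulTop x M) zs := by
  have hM : Nontrivial M := hreg.nontrivial
  have hne : ∀ (X : Type) [AddCommGroup X] [Module R X] [Module.Finite R X] [Nontrivial X],
      maximalIdeal R • (⊤ : Submodule R X) < ⊤ := by
    intro X _ _ _ _
    refine lt_top_iff_ne_top.mpr fun h => ?_
    exact not_subsingleton X (subsingleton_of_maximalIdeal_smul h.ge)
  let k : ModuleCat.{0} R := ModuleCat.of R (R ⧸ maximalIdeal R)
  have hk : Module.support R k = PrimeSpectrum.zeroLocus (maximalIdeal R : Set R) := by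
    rw [Module.support_eq_zeroLocus]
    congr 1
    exact congrArg _ (Ideal.annihilator_quotient)
  have hext := ModuleCat.subsingleton_ext_of_exists_isRegular (maximalIdeal R) k hk.subset
    (ModuleCat.of R M) (hne M) ys hys hreg
  have hnt : Nontrivial (QuotSMulTop x M) := by
    rw [QuotSMulTop, Submodule.Quotient.nontrivial_iff]
    intro h
    refine (hne M).ne (top_le_iff.mp (h.ge.trans ?_))
    rw [← Submodule.ideal_span_singleton_smul]
    exact Submodule.smul_mono_left ((Ideal.span_singleton_le_iff_mem _).mpr hx)
  refine ModuleCat.exists_isRegular_of_exists_subsingleton_ext (maximalIdeal R) d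
    (ModuleCat.of R (QuotSMulTop x M)) (hne _) k hk fun i hi => ?_
  have zero1 := AddCommGrpCat.isZero_of_iff_subsingleton.mpr (hext i (by omega))
  have zero2 := AddCommGrpCat.isZero_of_iff_subsingleton.mpr (hext (i + 1) (by omega))
  have hxM' : IsSMulRegular (ModuleCat.of R M) x := hxM
  exact AddCommGrpCat.subsingleton_of_isZero <| ShortComplex.Exact.isZero_of_both_zeros
    ((Ext.covariant_sequence_exact₃' k hxM'.smulShortComplex_shortExact) i (i + 1) rfl)
    (zero1.eq_zero_of_src _) (zero2.eq_zero_of_tgt _)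

theorem FinCol.submodule_smul_top {M : Type*} [AddCommGroup M] [Module R M] [Module.Finite R M]
    {I : Ideal R} (h : FinCol (I • (⊤ : Submodule R M))) (K : Submodule R M) :
    FinCol (I • (⊤ : Submodule R K)) := by
  obtain ⟨c, hc⟩ := exists_comap_le I K.subtype K.injective_subtype
  refine (finCol_comap (f := K.subtype) (h.pow_smul_top (c + 1))).mono ?_
  simpa using hc (c + 1)

theorem Sm.of_finCol {N : Type*} [AddCommGroup N] [Module R N] [Module.Finite R N]
    {xs : List R} (hxs : ∀ x ∈ xs, x ∈ maximalIdeal R)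
    (hQ : FinCol (Ideal.ofList xs • (⊤ : Submodule R N))) : Sm R (xs.length + 2) N := by
  obtain ⟨e, τ, h⟩ := exists_hilbData hQ
  have hQm : Ideal.ofList xs ≤ maximalIdeal R := Ideal.span_le.mpr hxs
  refine ⟨cl (Ideal.ofList xs • (⊤ : Submodule R N)), fun n => ?_⟩
  have h1 : hilb (maximalIdeal R) N n ≤
      cl (Ideal.ofList xs • (⊤ : Submodule R N)) * Nat.multichoose (xs.length + 1) n := by
    refine (cl_mono (hQ.pow_smul_top (n + 1))
      (Submodule.smul_mono_left (Ideal.pow_right_mono hQm _))).trans ?_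
    change hilb (Ideal.ofList xs) N n ≤ _
    rw [h.hilb_eq, multichoose_succ_eq_sum, Finset.mul_sum, Finset.mul_sum,
      ← Finset.sum_add_distrib]
    exact Finset.sum_le_sum fun j _ => h.bound j
  calc hilb (maximalIdeal R) N n * (n + 1) ^ 2
      ≤ cl (Ideal.ofList xs • (⊤ : Submodule R N)) * Nat.multichoose (xs.length + 1) n *
          (n + 1) ^ 2 := Nat.mul_le_mul_right _ h1
    _ = cl (Ideal.ofList xs • (⊤ : Submodule R N)) *
          ((Nat.multichoose (xs.length + 1) n * (n + 1)) * (n + 1)) := by ring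
    _ ≤ cl (Ideal.ofList xs • (⊤ : Submodule R N)) * ((n + 1) ^ (xs.length + 1) * (n + 1)) := by
        gcongr
        exact multichoose_mul_le_pow _ _
    _ = _ := by ring

/-- In a Cohen–Macaulay module, every system of parameters is a regular sequence. -/
theorem isWeaklyRegular_of_exists_isRegular {xs : List R} (hxs : ∀ x ∈ xs, x ∈ maximalIdeal R) :
    ∀ {M : Type} [AddCommGroup M] [Module R M] [Module.Finite R M],
      FinCol (Ideal.ofList xs • (⊤ : Submodule R M)) →
      (∃ ys : List R, ys.length = xs.length ∧ (∀ y ∈ ys, y ∈ maximalIdeal R) ∧ IsRegular M ys) →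
      IsWeaklyRegular M xs := by
  induction xs with
  | nil => exact fun _ _ => IsWeaklyRegular.nil _ _
  | cons x xs ih =>
    rintro M _ _ _ hQ ⟨ys, hlen, hys, hreg⟩
    have hxm := hxs x List.mem_cons_self
    have hxs' : ∀ z ∈ xs, z ∈ maximalIdeal R := fun z hz => hxs z (List.mem_cons_of_mem _ hz)
    let K := LinearMap.ker (LinearMap.lsmul R M x)
    have hK : FinCol (Ideal.ofList xs • (⊤ : Submodule R K)) := by
      refine (hQ.submodule_smul_top K).mono ?_
      rw [Ideal.ofList_cons_smul]
      refine sup_le ?_ le_rfl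
      rintro _ ⟨z, -, rfl⟩
      have : x • z = 0 := Subtype.ext z.2
      change x • z ∈ _
      rw [this]
      exact zero_mem _
    have hK0 : K = ⊥ := by
      refine eq_bot_of_isWeaklyRegular hys hreg.toIsWeaklyRegular K ?_
      rw [hlen]
      exact Sm.of_finCol hxs' hK
    have hxM : IsSMulRegular M x := LinearMap.ker_eq_bot.mp hK0
    obtain ⟨zs, h1, h2, h3⟩ := exists_isRegular_quotSMulTop hys hreg hxm hxM hlen
    exact (isWeaklyRegular_cons_iff M x xs).mpr
      ⟨hxM, ih hxs' (finCol_quotient_of_cons le_rfl hQ) ⟨zs, h1, h2, h3⟩⟩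

theorem HilbData.eq_cl_of_isWeaklyRegular {xs : List R} :
    ∀ {M : Type} [AddCommGroup M] [Module R M] [Module.Finite R M] {e : ℕ} {τ : ℕ → ℕ},
      HilbData xs M e τ → FinCol (Ideal.ofList xs • (⊤ : Submodule R M)) →
      IsWeaklyRegular M xs → e = cl (Ideal.ofList xs • (⊤ : Submodule R M)) := by
  induction xs with
  | nil =>
    intro M _ _ _ e τ h hQ _
    refine (h.eq_of_hilb_eq (f := fun _ => 0) (fun n => ?_) ⟨0, by simp⟩).1
    simp [hilb, Ideal.ofList_nil]
  | cons x xs ih =>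
    intro M _ _ _ e τ h hQ hreg
    obtain ⟨hx, hreg'⟩ := (isWeaklyRegular_cons_iff M x xs).mp hreg
    have hQ' : FinCol (Ideal.ofList xs • (⊤ : Submodule R (QuotSMulTop x M))) :=
      finCol_quotient_of_cons le_rfl hQ
    obtain ⟨e', τ', h'⟩ := exists_hilbData hQ'
    rw [(h.quotient hQ hx h').1, ih h' hQ' hreg', cl_quotient, Ideal.ofList_cons_smul]

/-- The Hilbert function of a parameter ideal generated by a regular sequence. -/
theorem hilb_eq_of_isWeaklyRegular {M : Type} [AddCommGroup M] [Module R M] [Module.Finite R M]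
    {xs : List R} (hQ : FinCol (Ideal.ofList xs • (⊤ : Submodule R M)))
    (hreg : IsWeaklyRegular M xs) (n : ℕ) :
    hilb (Ideal.ofList xs) M n =
      cl (Ideal.ofList xs • (⊤ : Submodule R M)) * Nat.multichoose (xs.length + 1) n := by
  obtain ⟨e, τ, h⟩ := exists_hilbData hQ
  have he := h.eq_cl_of_isWeaklyRegular hQ hreg
  have hτ : ∀ n, τ n = 0 := fun n => by
    have := h.bound n
    rw [← he] at this
    omega
  rw [h.hilb_eq, Finset.sum_eq_zero fun j _ => hτ j, ← he, add_zero]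

theorem eq_zero_of_sum_choose_eq_zero {k : ℕ} {a : ℕ → ℤ} {N : ℕ}
    (h : ∀ n ≥ N, ∑ j ∈ Finset.range k, a j * ((n + j).choose j : ℤ) = 0) :
    ∀ j < k, a j = 0 := by
  induction k generalizing a N with
  | zero => intro j hj; omega
  | succ k ih =>
    have h1 : ∀ j < k, a (j + 1) = 0 := by
      refine ih (a := fun j => a (j + 1)) (N := N + 1) fun n hn => ?_
      obtain ⟨n, rfl⟩ : ∃ m, n = m + 1 := ⟨n - 1, by omega⟩
      have h2 := h (n + 1) (by omega)
      have h3 := h n (by omega)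
      rw [Finset.sum_range_succ'] at h2 h3
      have h4 : ∀ j ∈ Finset.range k, a (j + 1) * ((n + 1 + j).choose j : ℤ) =
          a (j + 1) * ((n + 1 + (j + 1)).choose (j + 1) : ℤ) -
            a (j + 1) * ((n + (j + 1)).choose (j + 1) : ℤ) := by
        intro j _
        rw [show n + 1 + (j + 1) = (n + 1 + j) + 1 by omega, Nat.choose_succ_succ,
          show n + 1 + j = n + (j + 1) by omega]
        push_cast
        ring
      rw [Finset.sum_congr rfl h4, Finset.sum_sub_distrib]
      simp only [Nat.choose_zero_right, Nat.cast_one, mul_one] at h2 h3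
      linarith
    intro j hj
    rcases j with _ | j
    · have h2 := h N le_rfl
      rw [Finset.sum_range_succ', Finset.sum_eq_zero fun j hj => by
        rw [h1 j (Finset.mem_range.mp hj), zero_mul]] at h2
      simpa using h2
    · exact h1 j (by omega)

theorem coeff_one_eq_zero {r : ℕ} (hr : 1 ≤ r) {e : ℕ → ℤ} {c : ℤ} {N : ℕ}
    (h : ∀ n ≥ N, ∑ i ∈ Finset.range (r + 1),
      (-1 : ℤ) ^ i * e i * ((n + r - i).choose (r - i) : ℤ) = c * ((n + r).choose r : ℤ)) :
    e 1 = 0 := by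
  have h1 := eq_zero_of_sum_choose_eq_zero (k := r + 1) (N := N)
    (a := fun j => (-1) ^ (r - j) * e (r - j) - if j = r then c else 0) (fun n hn => by
      have h2 := h n hn
      rw [← Finset.sum_range_reflect] at h2
      simp only [sub_mul, Finset.sum_sub_distrib, ite_mul, zero_mul, Finset.sum_ite_eq',
        Finset.mem_range, Nat.lt_succ_self, if_true]
      rw [← h2, sub_eq_zero]
      refine Finset.sum_congr rfl fun j hj => ?_
      have := Finset.mem_range.mp hj
      rw [show r + 1 - 1 - j = r - j by omega, show n + r - (r - j) = n + j by omega,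
        show r - (r - j) = j by omega]) (r - 1) (by omega)
  simpa [show r - (r - 1) = 1 by omega, show r - 1 ≠ r by omega] using h1

end CohenMacaulay

theorem nontrivial_of_mDim_eq (R : Type) [CommRing R] (M : Type) [AddCommGroup M] [Module R M]
    {r : ℕ} (hr : mDim R M = (r : ℕ∞)) : Nontrivial M := by
  by_contra h
  rw [not_nontrivial_iff_subsingleton] at h
  have h1 : Submodule.annihilator (⊤ : Submodule R M) = ⊤ := by
    rw [Submodule.annihilator_top, Module.annihilator_eq_top_iff]
    exact h
  have h2 : Subsingleton (R ⧸ Submodule.annihilator (⊤ : Submodule R M)) :=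
    Ideal.Quotient.subsingleton_iff.mpr h1
  rw [mDim, ringKrullDim_eq_bot_of_subsingleton] at hr
  exact absurd hr (WithBot.bot_ne_coe)

theorem hilb_eq_of_hasHilbCoeffs {R : Type} [CommRing R] {I : Ideal R} {M : Type} [AddCommGroup M]
    [Module R M] {r : ℕ} {e : ℕ → ℤ} (he : HasHilbCoeffs R I M r e) :
    ∃ N, ∀ n ≥ N, (hilb I M n : ℤ) =
      ∑ i ∈ Finset.range (r + 1), (-1 : ℤ) ^ i * e i * ((n + r - i).choose (r - i) : ℤ) := by
  obtain ⟨N, hN⟩ := he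
  refine ⟨N, fun n hn => ?_⟩
  obtain ⟨l, h1, h2⟩ := hN n hn
  rw [← h2]
  change Order.krullDim _ = _ at h1
  rw [← Module.coe_length] at h1
  rw [hilb, cl, WithBot.coe_injective h1, ENat.toNat_natCast]

end HilbertVanishing

open HilbertVanishing

theorem statement5 (R : Type) [CommRing R] [IsLocalRing R] [IsNoetherianRing R]
    (M : Type) [AddCommGroup M] [Module R M] [Module.Finite R M]
    (r : ℕ) (hr : mDim R M = (r : ℕ∞)) (hr2 : 2 ≤ r)
    (hu : IsUnmixed R M)
    (Q : Ideal R) (hQ : IsParamIdeal R Q M r)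
    (e : ℕ → ℤ) (he : HasHilbCoeffs R Q M r e) :
    IsCM R M ↔ e 1 = 0 := by
  have hM : Nontrivial M := nontrivial_of_mDim_eq R M hr
  obtain ⟨hQm, ⟨x, hx⟩, hfin⟩ := hQ
  obtain ⟨xs, hlen, rfl⟩ : ∃ xs : List R, xs.length = r ∧ Q = Ideal.ofList xs := by
    refine ⟨List.ofFn x, List.length_ofFn, ?_⟩
    rw [hx, Ideal.ofList]
    congr 1
    ext y
    simp [List.mem_ofFn]
  subst hlen
  have hxs : ∀ y ∈ xs, y ∈ maximalIdeal R := fun y hy => hQm (Ideal.subset_span hy)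
  have hcol : FinCol (Ideal.ofList xs • (⊤ : Submodule R M)) := Module.length_ne_top_iff.mpr hfin
  obtain ⟨N, hN⟩ := hilb_eq_of_hasHilbCoeffs he
  constructor
  · rintro ⟨ys, hys, hreg, hdim⟩
    have hlen : ys.length = xs.length := by
      rw [hr] at hdim
      exact_mod_cast hdim
    have hreg' := isWeaklyRegular_of_exists_isRegular hxs hcol ⟨ys, hlen, hys, hreg⟩
    refine coeff_one_eq_zero (r := xs.length) (by omega) (N := N)
      (c := cl (Ideal.ofList xs • (⊤ : Submodule R M))) fun n hn => ?_
    rw [← hN n hn, hilb_eq_of_isWeaklyRegular hcol hreg' n, Nat.multichoose_eq,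
      show xs.length + 1 + n - 1 = n + xs.length by omega,
      Nat.choose_symm_add]
    push_cast
    rfl
  · intro he1
    have hstar := star_of_coeff_one_eq_zero hr2 hcol hN he1
    have hreg := isWeaklyRegular_of_star hxs hcol hstar fun p hp => (hu p hp).trans hr
    exact ⟨xs, hxs, RingTheory.Sequence.IsRegular.of_isWeaklyRegular_of_mem_maximalIdeal _
      hxs hreg, hr.symm⟩
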